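/- arXiv:2603.24404 — 16 statements merged into one kernel-verified Lean document; each statement's English description precedes it below -/
import Mathlib

section
/- Let V be a vector space over a field K, let m be a natural number, and let L₁, …, L_m : V → K be linear functionals. Set W = ⋂_{i=1}^m ker(L_i). If L : V → K is a linear functional that vanishes on W, then there exist scalars c₁, …, c_m ∈ K such that L = Σ_{i=1}^m c_i · L_i. -/
/-- If a linear functional `L` on a vector space `V` vanishes on the
intersection of the kernels of linear functionals `L₁, …, L_m`, then `L` is a linear
combination of the `Lᵢ`. -/
theorem stmt_0 {K V : Type*} [Field K] [AddCommGroup V] [Module K V]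
    (m : ℕ) (Li : Fin m → (V →ₗ[K] K)) (L : V →ₗ[K] K)
    (hL : ∀ v ∈ ⨅ i, LinearMap.ker (Li i), L v = 0) :
    ∃ c : Fin m → K, L = ∑ i, c i • Li i := by
  obtain ⟨c, hc⟩ := (Submodule.mem_span_range_iff_exists_fun K).1
    (mem_span_of_iInf_ker_le_ker (K := L) fun v hv ↦ LinearMap.mem_ker.2 (hL v hv))
  exact ⟨c, hc.symm⟩
end

section
/- Let A ⊆ K[x] be a subalgebra, and let α, β ∈ Kⁿ with α ≠ β be points such that there exists h ∈ A with h(α) ≠ h(β). Then a K-linear map L : A → K satisfies the Leibniz rule L(fg) = f(α)·L(g) + g(β)·L(f) for all f, g ∈ A if and only if there exists c ∈ K such that L(f) = c·(f(α) − f(β)) for all f ∈ A. -/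
set_option synthInstance.maxHeartbeats 1000000
set_option maxHeartbeats 1000000
open MvPolynomial

/-- For a subalgebra `A ⊆ K[x]` and distinct points `α ≠ β` separated by
some `h ∈ A`, a `K`-linear map `L : A → K` satisfies the Leibniz rule
`L(fg) = f(α)·L(g) + g(β)·L(f)` iff it is an `α,β`-character difference. -/
theorem stmt_1 {K : Type*} [Field K] [IsAlgClosed K] [CharZero K] {n : ℕ}
    (A : Subalgebra K (MvPolynomial (Fin n) K))
    (α β : Fin n → K) (hαβ : α ≠ β)
    (h : A) (hh : eval α (h : MvPolynomial (Fin n) K) ≠ eval β (h : MvPolynomial (Fin n) K))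
    (L : A →ₗ[K] K) :
    (∀ f g : A, L (f * g) =
        eval α (f : MvPolynomial (Fin n) K) * L g + eval β (g : MvPolynomial (Fin n) K) * L f)
      ↔ (∃ c : K, ∀ f : A,
          L f = c * (eval α (f : MvPolynomial (Fin n) K) - eval β (f : MvPolynomial (Fin n) K))) := by
  constructor
  · intro leibniz
    have hne := sub_ne_zero.mpr hh
    refine ⟨L h / (eval α (h : MvPolynomial (Fin n) K) - eval β (h : MvPolynomial (Fin n) K)),
      fun f => ?_⟩
    have comm := leibniz h f
    rw [mul_comm h f, leibniz f h] at comm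
    rw [div_mul_eq_mul_div, eq_div_iff hne]
    linear_combination -comm
  · rintro ⟨c, hc⟩ f g
    simp only [hc, MulMemClass.coe_mul, map_mul]
    ring
end

section
/- Let A ⊆ K[x] be a subalgebra of finite codimension and let L : A → K be a K-linear functional whose kernel is a unital K-subalgebra of A. Then there exist points α, β ∈ Kⁿ (possibly equal) such that L(fg) = f(α)·L(g) + g(β)·L(f) for all f, g ∈ A. -/
set_option synthInstance.maxHeartbeats 1000000
set_option maxHeartbeats 1000000

open MvPolynomial

/-- An algebra is a finite module over any subalgebra of finite codimension. -/
theorem Subalgebra.module_finite_of_finiteDimensional_quotient {K B : Type*} [Field K]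
    [CommRing B] [Algebra K B] (A : Subalgebra K B)
    [FiniteDimensional K (B ⧸ Subalgebra.toSubmodule A)] : Module.Finite A B := by
  obtain ⟨V, hV⟩ := (Subalgebra.toSubmodule A).exists_isCompl
  have : Module.Finite K V := Module.Finite.equiv (Submodule.quotientEquivOfIsCompl _ _ hV)
  obtain ⟨s, hs⟩ := Module.Finite.iff_fg.mp this
  classical
  refine ⟨⟨insert 1 s, eq_top_iff.mpr fun x _ => ?_⟩⟩
  obtain ⟨a, ha, v, hv, rfl⟩ := Submodule.mem_sup.mp (hV.sup_eq_top ▸ Submodule.mem_top (x := x))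
  refine add_mem ?_ ?_
  · have h : (⟨a, ha⟩ : A) • (1 : B) ∈ Submodule.span A (↑(insert 1 s) : Set B) :=
      Submodule.smul_mem _ _ (Submodule.subset_span (by simp))
    simpa [Subalgebra.smul_def] using h
  · rw [← hs] at hv
    have h := Submodule.span_le_restrictScalars K A (s : Set B) hv
    exact Submodule.span_mono (by simp) h

/-- Every character of a subalgebra of finite codimension of a polynomial ring over an
algebraically closed field is evaluation at a point. -/
theorem MvPolynomial.exists_eval_eq_of_subalgebra_algHom {K σ : Type*} [Field K] [IsAlgClosed K]
    [Finite σ] (A : Subalgebra K (MvPolynomial σ K))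
    [FiniteDimensional K (MvPolynomial σ K ⧸ Subalgebra.toSubmodule A)] (χ : A →ₐ[K] K) :
    ∃ α : σ → K, ∀ f : A, χ f = eval α (f : MvPolynomial σ K) := by
  have := A.module_finite_of_finiteDimensional_quotient
  have hχ : Function.Surjective χ := fun c => ⟨algebraMap K A c, by simp⟩
  have hm : (RingHom.ker χ).IsMaximal := RingHom.ker_isMaximal_of_surjective χ hχ
  obtain ⟨Q, hQ, hQm⟩ := Ideal.exists_ideal_over_maximal_of_isIntegral (S := MvPolynomial σ K)
    (RingHom.ker χ) (by
      rw [(RingHom.injective_iff_ker_eq_bot _).mp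
        (FaithfulSMul.algebraMap_injective A (MvPolynomial σ K))]
      exact bot_le)
  obtain ⟨α, rfl⟩ := MvPolynomial.isMaximal_iff_eq_vanishingIdeal_singleton.mp hQ
  refine ⟨α, fun f => ?_⟩
  have hf : f - algebraMap K A (χ f) ∈ RingHom.ker χ := by simp [RingHom.mem_ker]
  rw [← hQm, Ideal.mem_comap, mem_vanishingIdeal_singleton_iff] at hf
  have h : eval α ((f : MvPolynomial σ K) - C (χ f)) = 0 := hf
  rw [map_sub, eval_C, sub_eq_zero] at h
  exact h.symm

/-- A nonzero functional whose kernel is a unital subalgebra is a derivation with respect to a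
pair of characters. -/
theorem LinearMap.exists_algHom_map_mul_of_ker_subalgebra {K A : Type*} [Field K] [IsAlgClosed K]
    [CharZero K] [CommRing A] [Algebra K A] {L : A →ₗ[K] K} (hL : L ≠ 0) (h1 : L 1 = 0)
    (hmul : ∀ a b, L a = 0 → L b = 0 → L (a * b) = 0) :
    ∃ χ ψ : A →ₐ[K] K, ∀ f g, L (f * g) = χ f * L g + ψ g * L f := by
  obtain ⟨t, ht, ht2⟩ : ∃ t, L t = 1 ∧ L (t * t) = 0 := by
    obtain ⟨u, hu⟩ : ∃ u, L u = 1 := LinearMap.surjective hL 1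
    refine ⟨u - (L (u * u) / 2) • 1, by simp [hu, h1], ?_⟩
    have : (u - (L (u * u) / 2) • (1 : A)) * (u - (L (u * u) / 2) • 1) =
        u * u - L (u * u) • u + (L (u * u) / 2) ^ 2 • 1 := by
      simp only [Algebra.smul_def, mul_one]
      have h2 : algebraMap K A (L (u * u)) = 2 * algebraMap K A (L (u * u) / 2) := by
        rw [← map_ofNat (algebraMap K A) 2, ← map_mul]; congr 1; field_simp
      rw [h2, map_pow]; ring
    simp [this, hu, h1]
  have key : ∀ f g, L (f * g) = L (f * t) * L g + L (g * t) * L f := fun f g => by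
    have h := hmul (f - L f • t) (g - L g • t) (by simp [ht]) (by simp [ht])
    have e : (f - L f • t) * (g - L g • t) =
        f * g - L g • (f * t) - L f • (g * t) + (L f * L g) • (t * t) := by
      simp only [Algebra.smul_def, map_mul]; ring
    rw [e] at h
    simp only [map_add, map_sub, map_smul, smul_eq_mul, ht2] at h
    linear_combination h
  obtain ⟨μ, hμ⟩ := IsAlgClosed.exists_pow_nat_eq (L (t * t * t)) two_pos
  have key2 : ∀ f g, L (f * g * t) = L (f * t) * L (g * t) + L f * L g * μ ^ 2 := fun f g => by
    have h := key f (g * t)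
    have h' := key g (t * t)
    rw [← mul_assoc] at h
    rw [← mul_assoc] at h'
    rw [ht2] at h'
    linear_combination h + L f * h' - L f * L g * hμ
  let χ (ν : K) (hν : ν ^ 2 = μ ^ 2) : A →ₐ[K] K :=
    AlgHom.ofLinearMap (L ∘ₗ LinearMap.mulRight K t + ν • L) (by simp [ht, h1]) fun f g => by
      simp only [LinearMap.add_apply, LinearMap.comp_apply, LinearMap.mulRight_apply,
        LinearMap.smul_apply, smul_eq_mul]
      linear_combination key2 f g + ν * key f g - L f * L g * hν
  refine ⟨χ μ rfl, χ (-μ) (by ring), fun f g => ?_⟩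
  simp only [χ, AlgHom.ofLinearMap_apply, LinearMap.add_apply, LinearMap.comp_apply,
    LinearMap.mulRight_apply, LinearMap.smul_apply, smul_eq_mul]
  linear_combination key f g

/-- Every subalgebra condition on a finite-codimension subalgebra
`A ⊆ K[x]` (a linear functional whose kernel is a unital subalgebra) is an
`α,β`-subalgebra condition for some points `α, β ∈ Kⁿ`. -/
theorem stmt_2 {K : Type*} [Field K] [IsAlgClosed K] [CharZero K] {n : ℕ}
    (A : Subalgebra K (MvPolynomial (Fin n) K))
    [FiniteDimensional K (MvPolynomial (Fin n) K ⧸ Subalgebra.toSubmodule A)]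
    (L : A →ₗ[K] K)
    (hker : ∃ S : Subalgebra K A, (S : Set A) = {f : A | L f = 0}) :
    ∃ α β : Fin n → K, ∀ f g : A,
      L (f * g) =
        eval α (f : MvPolynomial (Fin n) K) * L g + eval β (g : MvPolynomial (Fin n) K) * L f := by
  obtain ⟨S, hS⟩ := hker
  have hmem : ∀ f : A, f ∈ S ↔ L f = 0 := fun f => Set.ext_iff.mp hS f
  by_cases hL : L = 0
  · exact ⟨0, 0, by simp [hL]⟩
  obtain ⟨χ, ψ, h⟩ := LinearMap.exists_algHom_map_mul_of_ker_subalgebra hL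
    ((hmem 1).mp S.one_mem) fun a b ha hb =>
      (hmem _).mp (S.mul_mem ((hmem a).mpr ha) ((hmem b).mpr hb))
  obtain ⟨α, hα⟩ := MvPolynomial.exists_eval_eq_of_subalgebra_algHom A χ
  obtain ⟨β, hβ⟩ := MvPolynomial.exists_eval_eq_of_subalgebra_algHom A ψ
  exact ⟨α, β, fun f g => by rw [h, hα, hβ]⟩
end

section
/- Let A ⊊ K[x] be a proper subalgebra of finite codimension. Then there exists a point α ∈ Kⁿ such that either there is a nonzero vector u = (u₁, …, uₙ) ∈ Kⁿ with Σ_{i=1}^n u_i·(∂f/∂x_i)(α) = 0 for all f ∈ A, or there is a point β ∈ Kⁿ with β ≠ α such that f(α) = f(β) for all f ∈ A. In other words, the subalgebra spectrum Sp(A) is nonempty. -/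
set_option synthInstance.maxHeartbeats 1000000
set_option maxHeartbeats 1000000

open MvPolynomial

/-- Over an algebraically closed field, a maximal ideal with finite-dimensional residue ring is
the kernel of a character. -/
theorem Ideal.IsMaximal.exists_algHom_ker_eq {K R : Type*} [Field K] [IsAlgClosed K] [CommRing R]
    [Algebra K R] (m : Ideal R) [m.IsMaximal] [Module.Finite K (R ⧸ m)] :
    ∃ χ : R →ₐ[K] K, ∀ x, χ x = 0 ↔ x ∈ m := by
  let _ : Field (R ⧸ m) := Ideal.Quotient.field m
  have hb : Function.Bijective (Algebra.ofId K (R ⧸ m)) :=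
    IsAlgClosed.algebraMap_bijective_of_isIntegral
  let e : K ≃ₐ[K] (R ⧸ m) := AlgEquiv.ofBijective (Algebra.ofId K (R ⧸ m)) hb
  refine ⟨(e.symm : (R ⧸ m) →ₐ[K] K).comp (Ideal.Quotient.mkₐ K m), fun x => ?_⟩
  simp [Ideal.Quotient.eq_zero_iff_mem]

/-- A finite-dimensional algebra that is not spanned by `1` has two distinct characters or a
nonzero point derivation. -/
theorem exists_algHom_ne_or_exists_pointDerivation {K R : Type*} [Field K] [IsAlgClosed K]
    [CommRing R] [Algebra K R] [Module.Finite K R]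
    (hR : ¬ Function.Surjective (algebraMap K R)) :
    (∃ χ₁ χ₂ : R →ₐ[K] K, χ₁ ≠ χ₂) ∨
      ∃ (χ : R →ₐ[K] K) (ψ : R →ₗ[K] K), ψ ≠ 0 ∧ ψ 1 = 0 ∧
        ∀ f g, ψ (f * g) = χ f * ψ g + χ g * ψ f := by
  have : Nontrivial R := by
    by_contra h
    rw [not_nontrivial_iff_subsingleton] at h
    exact hR fun x => ⟨0, Subsingleton.elim _ _⟩
  by_cases hloc : IsLocalRing R
  · right
    have : IsNoetherianRing R := IsNoetherianRing.of_finite K R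
    set n := IsLocalRing.maximalIdeal R
    obtain ⟨χ, hχ⟩ := Ideal.IsMaximal.exists_algHom_ker_eq (K := K) n
    have hsub : ∀ x, x - algebraMap K R (χ x) ∈ n := fun x => by
      rw [← hχ]; simp
    have hn : n ^ 2 ≠ n := by
      intro h
      have hbot : n = ⊥ := by
        refine Submodule.eq_bot_of_le_smul_of_le_jacobson_bot n n (IsNoetherian.noetherian n) ?_ ?_
        · rw [smul_eq_mul, ← pow_two, h]
        · exact (IsLocalRing.jacobson_eq_maximalIdeal ⊥ bot_ne_top).ge
      refine hR fun x => ⟨χ x, ?_⟩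
      have := hsub x
      rw [hbot, Ideal.mem_bot, sub_eq_zero] at this
      exact this.symm
    let W : Submodule K R := (n ^ 2).restrictScalars K ⊔ Submodule.span K {1}
    have hW : W < ⊤ := by
      rw [lt_top_iff_ne_top]
      intro h
      refine hn (le_antisymm (Ideal.pow_le_self two_ne_zero) fun x hx => ?_)
      have hxW : x ∈ W := h ▸ Submodule.mem_top
      obtain ⟨y, hy, z, hz, rfl⟩ := Submodule.mem_sup.1 hxW
      obtain ⟨c, rfl⟩ := Submodule.mem_span_singleton.1 hz
      have hy' : y ∈ n ^ 2 := hy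
      have h1 := (hχ _).2 hx
      have h2 := (hχ _).2 (Ideal.pow_le_self two_ne_zero hy')
      have hc : c = 0 := by simpa [h2] using h1
      simpa [hc] using hy'
    obtain ⟨ψ, hψ, hker⟩ := Submodule.exists_le_ker_of_lt_top W hW
    have hψ1 : ψ 1 = 0 :=
      hker (Submodule.mem_sup_right (Submodule.mem_span_singleton_self 1))
    refine ⟨χ, ψ, hψ, hψ1, fun f g => ?_⟩
    have hmem : (f - algebraMap K R (χ f)) * (g - algebraMap K R (χ g)) ∈ n ^ 2 := by
      rw [pow_two]; exact Ideal.mul_mem_mul (hsub f) (hsub g)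
    have h0 : ψ ((f - algebraMap K R (χ f)) * (g - algebraMap K R (χ g))) = 0 :=
      hker (Submodule.mem_sup_left hmem)
    have hexp : (f - algebraMap K R (χ f)) * (g - algebraMap K R (χ g)) =
        f * g - χ f • g - χ g • f + (χ f * χ g) • (1 : R) := by
      simp only [Algebra.smul_def, map_mul]; ring
    rw [hexp] at h0
    simp only [map_add, map_sub, map_smul, hψ1, smul_eq_mul] at h0
    linear_combination h0
  · left
    obtain ⟨m, hm⟩ := Ideal.exists_maximal R
    have : ∃ m' : Ideal R, m'.IsMaximal ∧ m' ≠ m := by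
      by_contra! h
      exact hloc (IsLocalRing.of_unique_max_ideal ⟨m, hm, h⟩)
    obtain ⟨m', hm', hne⟩ := this
    obtain ⟨χ, hχ⟩ := Ideal.IsMaximal.exists_algHom_ker_eq (K := K) m
    obtain ⟨χ', hχ'⟩ := Ideal.IsMaximal.exists_algHom_ker_eq (K := K) m'
    refine ⟨χ, χ', ?_⟩
    rintro rfl
    exact hne (Ideal.ext fun x => (hχ' x).symm.trans (hχ x))

/-- A proper subalgebra `A` of finite codimension maps to the scalars in some finite-dimensional
quotient of the ambient algebra that is not itself reduced to the scalars. -/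
theorem Subalgebra.exists_ideal_forall_mk_eq_algebraMap {K B : Type*} [Field K] [IsAlgClosed K]
    [CommRing B] [Algebra K B] (A : Subalgebra K B)
    [FiniteDimensional K (B ⧸ Subalgebra.toSubmodule A)] (hA : A ≠ ⊤) :
    ∃ I : Ideal B, Module.Finite K (B ⧸ I) ∧
      ¬ Function.Surjective (algebraMap K (B ⧸ I)) ∧
      ∀ f ∈ A, ∃ c : K, Ideal.Quotient.mk I f = algebraMap K (B ⧸ I) c := by
  let S : Submodule A B := 1
  have hS : ∀ x, x ∈ S ↔ x ∈ A := fun x => by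
    simp [S, Submodule.mem_one]
  have finS : Module.Finite K (B ⧸ S) := by
    have h : S.restrictScalars K = Subalgebra.toSubmodule A := by
      ext x; simpa using hS x
    have : Module.Finite K (B ⧸ S.restrictScalars K) := by rw [h]; infer_instance
    exact Module.Finite.equiv (Submodule.Quotient.restrictScalarsEquiv K S)
  have finA : Module.Finite A B := by
    have : Module.Finite A (B ⧸ S) := Module.Finite.of_restrictScalars_finite K A _
    have : Module.Finite A S := by
      refine Module.Finite.iff_fg.2 ?_
      simp only [S, Submodule.one_eq_span]
      exact Submodule.fg_span_singleton _
    exact Module.Finite.of_submodule_quotient S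
  have hStop : S ≠ ⊤ := fun h => hA (by
    ext x
    rw [← hS, h]
    simp)
  obtain ⟨N, hN, hSN⟩ := (eq_top_or_exists_le_coatom S).resolve_left hStop
  have : IsSimpleModule A (B ⧸ N) := isSimpleModule_iff_isCoatom.2 hN
  obtain ⟨m, hm, ⟨e⟩⟩ := isSimpleModule_iff_quot_maximal.1 this
  have finN : Module.Finite K (B ⧸ N) :=
    Module.Finite.of_surjective ((Submodule.factor hSN).restrictScalars K)
      (Submodule.factor_surjective hSN)
  have finm : Module.Finite K (A ⧸ m) := Module.Finite.equiv (e.restrictScalars K)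
  obtain ⟨χ, hχ⟩ := Ideal.IsMaximal.exists_algHom_ker_eq (K := K) m
  let I : Ideal B := m.map (algebraMap A B)
  have hsmul : ∀ a ∈ m, ∀ b : B, a • b ∈ N := fun a ha b => by
    rw [← Submodule.Quotient.mk_eq_zero, Submodule.Quotient.mk_smul, ← e.map_eq_zero_iff, map_smul]
    obtain ⟨r, hr⟩ := Ideal.Quotient.mk_surjective (e (Submodule.Quotient.mk b))
    rw [← hr, ← Ideal.Quotient.mk_eq_mk, ← Submodule.Quotient.mk_smul,
      Submodule.Quotient.mk_eq_zero]
    exact m.mul_mem_right _ ha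
  have hIN : ∀ x ∈ I, x ∈ N := fun x hx => by
    suffices h : ∀ b : B, b * x ∈ N by simpa using h 1
    refine Submodule.span_induction (p := fun x _ => ∀ b : B, b * x ∈ N) ?_ ?_ ?_ ?_ hx
    · rintro _ ⟨a, ha, rfl⟩ b
      rw [mul_comm]
      exact hsmul a ha b
    · simp
    · intro x y _ _ hx hy b
      rw [mul_add]
      exact N.add_mem (hx b) (hy b)
    · intro c x _ hx b
      rw [smul_eq_mul, ← mul_assoc]
      exact hx _
  have hmk : ∀ a : A, Ideal.Quotient.mk I (a : B) = algebraMap K (B ⧸ I) (χ a) := fun a => by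
    have h : a - algebraMap K A (χ a) ∈ m := by rw [← hχ]; simp
    have h' := Ideal.mem_map_of_mem (algebraMap A B) h
    exact Ideal.Quotient.eq.2 h'
  refine ⟨I, ?_, ?_, fun f hf => ⟨χ ⟨f, hf⟩, hmk ⟨f, hf⟩⟩⟩
  · have : Module.Finite A (B ⧸ I) :=
      Module.Finite.of_surjective (Ideal.Quotient.mkₐ A I).toLinearMap
        Ideal.Quotient.mk_surjective
    obtain ⟨s, hs⟩ := this.fg_top
    refine ⟨⟨s, eq_top_iff.2 fun x _ => ?_⟩⟩
    have hx : x ∈ Submodule.span A (s : Set (B ⧸ I)) := hs ▸ Submodule.mem_top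
    induction hx using Submodule.span_induction with
    | mem x h => exact Submodule.subset_span h
    | zero => exact Submodule.zero_mem _
    | add x y _ _ hx hy => exact Submodule.add_mem _ (hx trivial) (hy trivial)
    | smul a x _ hx =>
      have : a • x = χ a • x := by
        rw [Algebra.smul_def, Algebra.smul_def, ← hmk]
        rfl
      rw [this]
      exact Submodule.smul_mem _ _ (hx trivial)
  · intro hsurj
    refine hN.1 (eq_top_iff.2 fun x _ => ?_)
    obtain ⟨c, hc⟩ := hsurj (Ideal.Quotient.mk I x)
    have hmem : x - algebraMap K B c ∈ I := Ideal.Quotient.eq.1 hc.symm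
    have h2 : algebraMap K B c ∈ N := hSN ((hS _).2 (A.algebraMap_mem c))
    simpa using N.add_mem (hIN _ hmem) h2

/-- A point derivation on polynomials is a directional derivative. -/
theorem MvPolynomial.pointDerivation_eq_sum {K σ : Type*} [Field K] [Fintype σ]
    (α : σ → K) (ψ : MvPolynomial σ K →ₗ[K] K) (h1 : ψ 1 = 0)
    (hmul : ∀ f g, ψ (f * g) = eval α f * ψ g + eval α g * ψ f) (f : MvPolynomial σ K) :
    ψ f = ∑ i, ψ (X i) * eval α (pderiv i f) := by
  classical
  induction f using MvPolynomial.induction_on with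
  | C c =>
    have : (C c : MvPolynomial σ K) = c • 1 := by rw [smul_eq_C_mul, mul_one]
    rw [this]
    simp [h1]
  | add p q hp hq => simp [hp, hq, mul_add, Finset.sum_add_distrib]
  | mul_X p j hp =>
    have hj : ∑ i, ψ (X i) * (eval α p * eval α (pderiv i (X j))) = eval α p * ψ (X j) := by
      rw [Finset.sum_eq_single j]
      · simp [mul_comm]
      · intro i _ hij
        rw [pderiv_X_of_ne hij.symm]
        simp
      · simp
    rw [hmul, hp]
    simp only [Derivation.leibniz, smul_eq_mul, map_add, map_mul, mul_add,
      Finset.sum_add_distrib, hj]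
    rw [Finset.mul_sum]
    congr 1
    exact Finset.sum_congr rfl fun i _ => by ring

/-- A proper subalgebra `A ⊊ K[x]` of finite codimension has nonempty
subalgebra spectrum: there is a point `α` at which either some nonzero directional
derivative annihilates all of `A`, or which `A` fails to separate from another point `β`. -/
theorem stmt_4 {K : Type*} [Field K] [IsAlgClosed K] [CharZero K] {n : ℕ}
    (A : Subalgebra K (MvPolynomial (Fin n) K))
    [FiniteDimensional K (MvPolynomial (Fin n) K ⧸ Subalgebra.toSubmodule A)]
    (hA : A ≠ ⊤) :
    ∃ α : Fin n → K,
      (∃ u : Fin n → K, u ≠ 0 ∧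
          ∀ f ∈ A, ∑ i : Fin n, u i * eval α (pderiv i f) = 0) ∨
      (∃ β : Fin n → K, β ≠ α ∧ ∀ f ∈ A, eval α f = eval β f) := by
  obtain ⟨I, hfin, hsurj, hAI⟩ := A.exists_ideal_forall_mk_eq_algebraMap hA
  let π := Ideal.Quotient.mkₐ K I
  have hπ : Function.Surjective π := Ideal.Quotient.mk_surjective
  have heval : ∀ (χ : (MvPolynomial (Fin n) K ⧸ I) →ₐ[K] K) (f),
      χ (π f) = eval (fun i => χ (π (X i))) f := fun χ f => by
    have : χ.comp π = aeval fun i => χ (π (X i)) := by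
      ext i
      simp
    rw [← AlgHom.comp_apply, this, aeval_eq_eval]
  rcases exists_algHom_ne_or_exists_pointDerivation hsurj with
    ⟨χ₁, χ₂, hne⟩ | ⟨χ, ψ, hψ, hψ1, hmul⟩
  · refine ⟨fun i => χ₁ (π (X i)), Or.inr ⟨fun i => χ₂ (π (X i)), fun h => hne ?_, ?_⟩⟩
    · ext x
      obtain ⟨f, rfl⟩ := hπ x
      rw [heval χ₁, heval χ₂, h]
    · intro f hf
      obtain ⟨c, hc⟩ := hAI f hf
      have hc' : π f = algebraMap K _ c := hc
      rw [← heval, ← heval, hc', AlgHom.commutes, AlgHom.commutes]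
  · have key := MvPolynomial.pointDerivation_eq_sum (fun i => χ (π (X i)))
      (ψ.comp π.toLinearMap) (by simpa using hψ1) (fun f g => by
        rw [← heval, ← heval]
        simp [hmul])
    refine ⟨fun i => χ (π (X i)), Or.inl ⟨fun i => ψ (π (X i)), fun h => hψ ?_, ?_⟩⟩
    · ext x
      obtain ⟨f, rfl⟩ := hπ x
      refine (key f).trans (Finset.sum_eq_zero fun i _ => ?_)
      have : ψ (π (X i)) = 0 := congrFun h i
      simp [this]
    · intro f hf
      obtain ⟨c, hc⟩ := hAI f hf
      have hc' : π f = algebraMap K _ c := hc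
      refine (key f).symm.trans ?_
      simp only [LinearMap.comp_apply, AlgHom.toLinearMap_apply]
      rw [hc', Algebra.algebraMap_eq_smul_one, map_smul, hψ1, smul_zero]
end

section
/- Let A, B ⊆ K[x] be subalgebras of finite codimension and let φ : A → B be an isomorphism of K-algebras. Then the codimension of A in K[x] equals the codimension of B in K[x], and φ extends to a K-algebra automorphism Φ of K[x], i.e., there exists a K-algebra automorphism Φ : K[x] → K[x] such that Φ(a) = φ(a) for all a ∈ A. -/
set_option synthInstance.maxHeartbeats 1000000
set_option maxHeartbeats 1000000

open MvPolynomial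

/-- A subalgebra of finite codimension in a polynomial ring contains a common nonzero
denominator for any two polynomials. -/
theorem exists_ne_zero_mul_mem_of_finite_codim {K : Type*} [Field K] {n : ℕ}
    (A : Subalgebra K (MvPolynomial (Fin n) K))
    [FiniteDimensional K (MvPolynomial (Fin n) K ⧸ Subalgebra.toSubmodule A)]
    (p q : MvPolynomial (Fin n) K) :
    ∃ a ∈ A, a ≠ 0 ∧ a * p ∈ A ∧ a * q ∈ A := by
  rcases n with _ | n
  · have h (r : MvPolynomial (Fin 0) K) : r ∈ A := by
      rw [eq_C_of_isEmpty r]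
      exact A.algebraMap_mem _
    exact ⟨1, h _, one_ne_zero, h _, h _⟩
  · have hA : ¬ Module.Finite K (Subalgebra.toSubmodule A) := fun _ => by
      have : Module.Finite K (MvPolynomial (Fin (n + 1)) K) :=
        Module.Finite.of_submodule_quotient (Subalgebra.toSubmodule A)
      have := Module.Finite.finite_basis (basisMonomials (Fin (n + 1)) K)
      exact not_finite (Fin (n + 1) →₀ ℕ)
    let m (r : MvPolynomial (Fin (n + 1)) K) :=
      (Subalgebra.toSubmodule A).mkQ ∘ₗ LinearMap.mulRight K r ∘ₗ
        (Subalgebra.toSubmodule A).subtype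
    have hm : ¬ Function.Injective ((m p).prod (m q)) := fun h =>
      hA (Module.Finite.of_injective _ h)
    rw [← LinearMap.ker_eq_bot, Submodule.eq_bot_iff] at hm
    push Not at hm
    obtain ⟨a, ha, ha0⟩ := hm
    have ha : m p a = 0 ∧ m q a = 0 := by simpa using ha
    refine ⟨a, a.2, by simpa using ha0, ?_, ?_⟩
    · simpa [m] using ha.1
    · simpa [m] using ha.2

/-- A subalgebra of finite codimension in a polynomial ring has the same fraction field. -/
theorem isFractionRing_of_finite_codim {K : Type*} [Field K] {n : ℕ}
    (A : Subalgebra K (MvPolynomial (Fin n) K))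
    [FiniteDimensional K (MvPolynomial (Fin n) K ⧸ Subalgebra.toSubmodule A)] :
    IsFractionRing A (FractionRing (MvPolynomial (Fin n) K)) := by
  have : FaithfulSMul A (FractionRing (MvPolynomial (Fin n) K)) := by
    rw [faithfulSMul_iff_algebraMap_injective]
    exact (IsFractionRing.injective (MvPolynomial (Fin n) K) _).comp Subtype.val_injective
  refine IsFractionRing.of_field A _ fun z => ?_
  obtain ⟨p, q, hq, rfl⟩ := IsFractionRing.div_surjective (A := MvPolynomial (Fin n) K) z
  obtain ⟨a, -, ha0, hp, hq'⟩ := exists_ne_zero_mul_mem_of_finite_codim A p q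
  refine ⟨⟨a * p, hp⟩, ⟨a * q, hq'⟩, ?_⟩
  change _ = algebraMap (MvPolynomial (Fin n) K) _ (a * p) /
    algebraMap (MvPolynomial (Fin n) K) _ (a * q)
  rw [map_mul, map_mul, mul_div_mul_left]
  simpa using ha0

/-- A `K`-algebra is integral over each of its subalgebras of finite codimension. -/
theorem isIntegral_of_finite_codim {K R : Type*} [Field K] [CommRing R] [Algebra K R]
    (A : Subalgebra K R) [FiniteDimensional K (R ⧸ Subalgebra.toSubmodule A)] :
    Algebra.IsIntegral A R := by
  have : Module.Finite A (R ⧸ LinearMap.range (Algebra.linearMap A R)) := by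
    have : Module.Finite K (R ⧸ LinearMap.range (Algebra.linearMap A R)) := by
      let f : (R ⧸ Subalgebra.toSubmodule A) →ₗ[K]
          (R ⧸ LinearMap.range (Algebra.linearMap A R)) :=
        (Subalgebra.toSubmodule A).liftQ
          ((LinearMap.range (Algebra.linearMap A R)).mkQ.restrictScalars K) (fun a ha => by
            simpa using ha)
      refine Module.Finite.of_surjective f fun z => ?_
      obtain ⟨r, rfl⟩ := Submodule.Quotient.mk_surjective _ z
      exact ⟨Submodule.Quotient.mk r, rfl⟩
    exact Module.Finite.of_restrictScalars_finite K A _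
  have : Module.Finite A R :=
    Module.Finite.of_submodule_quotient (LinearMap.range (Algebra.linearMap A R))
  exact Algebra.IsIntegral.of_finite A R

/-- An endomorphism of the fraction field of an integrally closed domain `R` that maps a
subalgebra over which `R` is integral into `R` restricts to an endomorphism of `R`. -/
theorem exists_algHom_of_isIntegral {K R F : Type*} [Field K] [CommRing R] [IsDomain R]
    [IsIntegrallyClosed R] [Algebra K R] [Field F] [Algebra K F] [Algebra R F]
    [IsScalarTower K R F] [IsFractionRing R F] (A : Subalgebra K R) [Algebra.IsIntegral A R]
    (ψ : F →ₐ[K] F) (g : A →+* R) (h : ∀ a : A, ψ (algebraMap R F a) = algebraMap R F (g a)) :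
    ∃ Φ : R →ₐ[K] R, ∀ r, algebraMap R F (Φ r) = ψ (algebraMap R F r) := by
  let ι : R →ₐ[K] F := IsScalarTower.toAlgHom K R F
  have hι : Function.Injective ι := IsFractionRing.injective R F
  have key (r : R) : ψ.comp ι r ∈ ι.range := by
    obtain ⟨f, hf, hfr⟩ := Algebra.IsIntegral.isIntegral (R := A) r
    refine IsIntegrallyClosed.isIntegral_iff.mp ⟨f.map g, hf.map g, ?_⟩
    have := congrArg (ψ.comp ι) hfr
    rw [map_zero, ← AlgHom.coe_toRingHom, Polynomial.hom_eval₂] at this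
    rw [Polynomial.eval₂_map, ← this]
    congr 1
    ext a
    exact (h a).symm
  let e := AlgEquiv.ofInjective ι hι
  refine ⟨(e.symm : _ →ₐ[K] R).comp ((ψ.comp ι).codRestrict ι.range key), fun r => ?_⟩
  exact congrArg Subtype.val (e.apply_symm_apply ((ψ.comp ι).codRestrict ι.range key r))

/-- Isomorphic subalgebras of finite codimension in `K[x]` have the same
codimension, and any `K`-algebra isomorphism between them extends to a `K`-algebra
automorphism of `K[x]`. -/
theorem stmt_7 {K : Type*} [Field K] [IsAlgClosed K] [CharZero K] {n : ℕ}
    (A B : Subalgebra K (MvPolynomial (Fin n) K))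
    [FiniteDimensional K (MvPolynomial (Fin n) K ⧸ Subalgebra.toSubmodule A)]
    [FiniteDimensional K (MvPolynomial (Fin n) K ⧸ Subalgebra.toSubmodule B)]
    (φ : A ≃ₐ[K] B) :
    Module.finrank K (MvPolynomial (Fin n) K ⧸ Subalgebra.toSubmodule A) =
        Module.finrank K (MvPolynomial (Fin n) K ⧸ Subalgebra.toSubmodule B) ∧
      ∃ Φ : MvPolynomial (Fin n) K ≃ₐ[K] MvPolynomial (Fin n) K,
        ∀ a : A, Φ (a : MvPolynomial (Fin n) K) = (φ a : MvPolynomial (Fin n) K) := by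
  let P := MvPolynomial (Fin n) K
  let F := FractionRing P
  have := isFractionRing_of_finite_codim A
  have := isFractionRing_of_finite_codim B
  have := isIntegral_of_finite_codim A
  have := isIntegral_of_finite_codim B
  have hinj : Function.Injective (algebraMap P F) := IsFractionRing.injective P F
  let ψ : F ≃ₐ[K] F := IsFractionRing.fieldEquivOfAlgEquiv K F F φ
  have hψ (a : A) : ψ (algebraMap P F a) = algebraMap P F (φ a) :=
    IsFractionRing.fieldEquivOfAlgEquiv_algebraMap K F F φ a
  have hψ' (b : B) : ψ.symm (algebraMap P F b) = algebraMap P F (φ.symm b) := by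
    rw [AlgEquiv.symm_apply_eq, hψ, AlgEquiv.apply_symm_apply]
  obtain ⟨Φ, hΦ⟩ := exists_algHom_of_isIntegral A (ψ : F →ₐ[K] F)
    (B.val.comp (φ : A →ₐ[K] B)).toRingHom hψ
  obtain ⟨Φ', hΦ'⟩ := exists_algHom_of_isIntegral B (ψ.symm : F →ₐ[K] F)
    (A.val.comp (φ.symm : B →ₐ[K] A)).toRingHom hψ'
  let E : P ≃ₐ[K] P := AlgEquiv.ofAlgHom Φ Φ'
    (AlgHom.ext fun p => hinj <| by
      rw [AlgHom.comp_apply, hΦ, hΦ']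
      exact ψ.apply_symm_apply _)
    (AlgHom.ext fun p => hinj <| by
      rw [AlgHom.comp_apply, hΦ', hΦ]
      exact ψ.symm_apply_apply _)
  have hE (a : A) : E a = φ a := hinj <| (hΦ a).trans (hψ a)
  refine ⟨LinearEquiv.finrank_eq (Submodule.Quotient.equiv _ _ E.toLinearEquiv ?_), E, hE⟩
  ext b
  constructor
  · rintro ⟨a, ha, rfl⟩
    exact (hE ⟨a, ha⟩).symm ▸ (φ ⟨a, ha⟩).2
  · intro hb
    refine ⟨φ.symm ⟨b, hb⟩, (φ.symm ⟨b, hb⟩).2, ?_⟩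
    exact (hE _).trans (by rw [AlgEquiv.apply_symm_apply])
end

section
/- Let A ⊆ K[x] be a subalgebra of finite codimension and let L : A → K be a nonzero K-linear functional which satisfies both L(fg) = f(α)·L(g) + g(β)·L(f) for all f, g ∈ A and L(fg) = f(γ)·L(g) + g(δ)·L(f) for all f, g ∈ A, for points α, β, γ, δ ∈ Kⁿ. Then either (α ∼ γ and β ∼ δ) or (α ∼ δ and β ∼ γ), where for points p, q ∈ Kⁿ, p ∼ q means f(p) = f(q) for all f ∈ A. -/
set_option synthInstance.maxHeartbeats 1000000
set_option maxHeartbeats 1000000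

open MvPolynomial

/-- If two ring homomorphisms into a domain of characteristic zero have the same sum as two others,
then the two pairs agree up to order. -/
theorem RingHom.eq_and_eq_or_of_add_eq_add {R S : Type*} [Ring R] [CommRing S] [IsDomain S]
    [CharZero S] (a b c d : R →+* S) (h : ∀ f, a f + b f = c f + d f) :
    (a = c ∧ b = d) ∨ (a = d ∧ b = c) := by
  have key : ∀ f, a f = c f ∨ a f = d f := by
    intro f
    have hsq := h (f * f)
    simp only [map_mul] at hsq
    have hprod : (2 : S) * ((a f - c f) * (a f - d f)) = 0 := by
      linear_combination hsq + (a f - b f - c f - d f) * h f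
    rcases mul_eq_zero.mp ((mul_eq_zero.mp hprod).resolve_left two_ne_zero) with h0 | h0
    · exact Or.inl (sub_eq_zero.mp h0)
    · exact Or.inr (sub_eq_zero.mp h0)
  have hac : a = c ∨ a = d := by
    by_contra! hne
    obtain ⟨f, hf⟩ := DFunLike.ne_iff.mp hne.1
    obtain ⟨g, hg⟩ := DFunLike.ne_iff.mp hne.2
    have hf' := (key f).resolve_left hf
    have hg' := (key g).resolve_right hg
    rcases key (f + g) with hfg | hfg
    · rw [map_add, map_add, hg'] at hfg
      exact hf (add_right_cancel hfg)
    · rw [map_add, map_add, hf'] at hfg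
      exact hg (add_left_cancel hfg)
  rcases hac with rfl | rfl
  · exact Or.inl ⟨rfl, RingHom.ext fun f => add_left_cancel (h f)⟩
  · exact Or.inr ⟨rfl, RingHom.ext fun f => add_left_cancel ((h f).trans (add_comm _ _))⟩

/-- If a nonzero linear functional on a finite-codimension subalgebra
`A ⊆ K[x]` is both an `α,β`- and a `γ,δ`-subalgebra condition, then either `α ∼ γ` and
`β ∼ δ`, or `α ∼ δ` and `β ∼ γ` (where `p ∼ q` means `f(p) = f(q)` for all `f ∈ A`). -/
theorem stmt_8 {K : Type*} [Field K] [IsAlgClosed K] [CharZero K] {n : ℕ}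
    (A : Subalgebra K (MvPolynomial (Fin n) K))
    [FiniteDimensional K (MvPolynomial (Fin n) K ⧸ Subalgebra.toSubmodule A)]
    (L : A →ₗ[K] K) (hL : L ≠ 0)
    (α β γ δ : Fin n → K)
    (h1 : ∀ f g : A, L (f * g) =
      eval α (f : MvPolynomial (Fin n) K) * L g + eval β (g : MvPolynomial (Fin n) K) * L f)
    (h2 : ∀ f g : A, L (f * g) =
      eval γ (f : MvPolynomial (Fin n) K) * L g + eval δ (g : MvPolynomial (Fin n) K) * L f) :
    ((∀ f ∈ A, eval α f = eval γ f) ∧ (∀ f ∈ A, eval β f = eval δ f)) ∨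
      ((∀ f ∈ A, eval α f = eval δ f) ∧ (∀ f ∈ A, eval β f = eval γ f)) := by
  obtain ⟨g, hg⟩ : ∃ g, L g ≠ 0 := by
    by_contra! h
    exact hL (LinearMap.ext h)
  have hsum : ∀ f : A, eval α (f : MvPolynomial (Fin n) K) + eval β (f : MvPolynomial (Fin n) K) =
      eval γ (f : MvPolynomial (Fin n) K) + eval δ (f : MvPolynomial (Fin n) K) := by
    intro f
    have hfg := (h1 f g).symm.trans (h2 f g)
    have hgf := (h1 g f).symm.trans (h2 g f)
    have hgg := (h1 g g).symm.trans (h2 g g)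
    refine mul_right_cancel₀ (mul_ne_zero hg hg) ?_
    linear_combination L g * hfg + L g * hgf - L f * hgg
  rcases RingHom.eq_and_eq_or_of_add_eq_add ((eval α).comp A.val.toRingHom)
    ((eval β).comp A.val.toRingHom) ((eval γ).comp A.val.toRingHom)
    ((eval δ).comp A.val.toRingHom) hsum with ⟨h, h'⟩ | ⟨h, h'⟩
  · exact Or.inl ⟨fun f hf => DFunLike.congr_fun h ⟨f, hf⟩,
      fun f hf => DFunLike.congr_fun h' ⟨f, hf⟩⟩
  · exact Or.inr ⟨fun f hf => DFunLike.congr_fun h ⟨f, hf⟩,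
      fun f hf => DFunLike.congr_fun h' ⟨f, hf⟩⟩
end

section
/- Let A ⊆ K[x] be a subalgebra of finite codimension and let α, γ ∈ Kⁿ be points that are not equivalent in A, i.e., there exists h ∈ A with h(α) ≠ h(γ). If a K-linear map L : A → K is simultaneously an α-derivation and a γ-derivation, then L = 0. -/
set_option synthInstance.maxHeartbeats 1000000
set_option maxHeartbeats 1000000

open MvPolynomial

/-- If `α` and `γ` are not equivalent in a finite-codimension subalgebra
`A ⊆ K[x]`, then a linear map `L : A → K` which is simultaneously an `α`-derivation and a
`γ`-derivation must vanish. -/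
theorem stmt_10 {K : Type*} [Field K] [IsAlgClosed K] [CharZero K] {n : ℕ}
    (A : Subalgebra K (MvPolynomial (Fin n) K))
    [FiniteDimensional K (MvPolynomial (Fin n) K ⧸ Subalgebra.toSubmodule A)]
    (α γ : Fin n → K)
    (hsep : ∃ h : A, eval α (h : MvPolynomial (Fin n) K) ≠ eval γ (h : MvPolynomial (Fin n) K))
    (L : A →ₗ[K] K)
    (hα : ∀ f g : A, L (f * g) =
      eval α (f : MvPolynomial (Fin n) K) * L g + L f * eval α (g : MvPolynomial (Fin n) K))
    (hγ : ∀ f g : A, L (f * g) =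
      eval γ (f : MvPolynomial (Fin n) K) * L g + L f * eval γ (g : MvPolynomial (Fin n) K)) :
    L = 0 := by
  obtain ⟨h, hh⟩ := hsep
  have key (f g : A) :
      (eval α (f : MvPolynomial (Fin n) K) - eval γ (f : MvPolynomial (Fin n) K)) * L g +
        L f * (eval α (g : MvPolynomial (Fin n) K) - eval γ (g : MvPolynomial (Fin n) K)) = 0 := by
    linear_combination hγ f g - hα f g
  have hd := sub_ne_zero.mpr hh
  have hLh : L h = 0 := by
    have h2 : (2 * L h) * (eval α (h : MvPolynomial (Fin n) K) -
        eval γ (h : MvPolynomial (Fin n) K)) = 0 := by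
      linear_combination key h h
    simpa [hd] using h2
  ext g
  simpa [hLh, hd] using key h g
end

section
/- Let A ⊆ K[x] be a subalgebra of finite codimension, α ∈ Kⁿ, and let L : A → K be a K-linear functional whose kernel is a unital subalgebra of A and which is not an α-derivation (i.e., it is not the case that L(fg) = f(α)·L(g) + L(f)·g(α) for all f, g ∈ A). Set A' = ker(L). If D : A → K is an α-derivation on A that vanishes on A', then D = 0. Consequently, the restriction map from the space of α-derivations on A to functionals on A' is injective, so dim(D_α(A)|_{A'}) = dim(D_α(A)). -/
set_option synthInstance.maxHeartbeats 1000000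
set_option maxHeartbeats 1000000

open MvPolynomial

/-- The `K`-vector space of `α`-derivations on a subalgebra `A ⊆ K[x]`:
linear functionals `D : A → K` with `D(fg) = f(α)·D(g) + D(f)·g(α)`. -/
def derivationSpace {K : Type*} [Field K] {n : ℕ}
    (A : Subalgebra K (MvPolynomial (Fin n) K)) (α : Fin n → K) :
    Submodule K (A →ₗ[K] K) where
  carrier := {D | ∀ f g : A, D (f * g) =
      eval α (f : MvPolynomial (Fin n) K) * D g + D f * eval α (g : MvPolynomial (Fin n) K)}
  add_mem' := by
    intro D E hD hE f g
    simp only [LinearMap.add_apply, hD f g, hE f g]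
    ring
  zero_mem' := by
    intro f g
    simp
  smul_mem' := by
    intro c D hD f g
    simp only [LinearMap.smul_apply, hD f g, smul_eq_mul]
    ring

theorem LinearMap.exists_eq_smul_of_ker_le_ker {K V : Type*} [Field K] [AddCommGroup V] [Module K V]
    {L D : V →ₗ[K] K} (h : ∀ v, L v = 0 → D v = 0) : ∃ c : K, D = c • L := by
  have hmem : D ∈ Submodule.span K (Set.range fun _ : Unit => L) :=
    mem_span_of_iInf_ker_le_ker fun v hv => h v (by simpa using hv)
  obtain ⟨c, hc⟩ := Submodule.mem_span_singleton.mp (by simpa using hmem)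
  exact ⟨c, hc.symm⟩

/-- Let `L : A → K` be a subalgebra condition (its kernel is a unital
subalgebra) on a finite-codimension subalgebra `A ⊆ K[x]` which is *not* an
`α`-derivation, and let `A' = ker L`. Then every `α`-derivation on `A` vanishing on `A'`
is zero; consequently restriction to `A'` is injective on `α`-derivations and the space of
restrictions has the same dimension as `D_α(A)`. -/
theorem stmt_11 {K : Type*} [Field K] [IsAlgClosed K] [CharZero K] {n : ℕ}
    (A : Subalgebra K (MvPolynomial (Fin n) K))
    [FiniteDimensional K (MvPolynomial (Fin n) K ⧸ Subalgebra.toSubmodule A)]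
    (α : Fin n → K) (L : A →ₗ[K] K)
    (hker : ∃ S : Subalgebra K A, (S : Set A) = {f : A | L f = 0})
    (hnotderiv : ¬ (∀ f g : A, L (f * g) =
      eval α (f : MvPolynomial (Fin n) K) * L g + L f * eval α (g : MvPolynomial (Fin n) K))) :
    (∀ D : A →ₗ[K] K, D ∈ derivationSpace A α → (∀ f : A, L f = 0 → D f = 0) → D = 0) ∧
      Module.rank K
          (Submodule.map (LinearMap.lcomp K K (LinearMap.ker L).subtype) (derivationSpace A α)) =
        Module.rank K (derivationSpace A α) := by
  have hzero : ∀ D : A →ₗ[K] K, D ∈ derivationSpace A α →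
      (∀ f : A, L f = 0 → D f = 0) → D = 0 := by
    intro D hD hDL
    obtain ⟨c, rfl⟩ := LinearMap.exists_eq_smul_of_ker_le_ker hDL
    by_cases hc : c = 0
    · simp [hc]
    · exact absurd (((derivationSpace A α).smul_mem_iff hc).mp hD) hnotderiv
  refine ⟨hzero, ?_⟩
  let φ := (LinearMap.lcomp K K (LinearMap.ker L).subtype).domRestrict (derivationSpace A α)
  have hinj : Function.Injective φ := by
    rw [injective_iff_map_eq_zero]
    intro D hD
    exact Subtype.ext (hzero D D.2 fun f hf => LinearMap.congr_fun hD ⟨f, hf⟩)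
  rw [← LinearMap.range_domRestrict]
  exact rank_range_of_injective φ hinj
end

section
/- Fix a monomial (term) order on K[x]. Let B ⊆ A ⊆ K[x] be K-linear subspaces of the polynomial ring such that the quotient space A/B is finite-dimensional over K. Then dim_K(A/B) = |Lm(A) \ Lm(B)|, where Lm(S) denotes the set of leading monomials of the nonzero elements of a set S of polynomials with respect to the fixed monomial order. -/
set_option synthInstance.maxHeartbeats 1000000
set_option maxHeartbeats 1000000

open MvPolynomial

/-- The leading monomial of a nonzero multivariate polynomial with respect to a
monomial order `m`: the `m`-largest exponent appearing in its support. -/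
noncomputable def leadingMonomial {K : Type*} [Field K] {n : ℕ}
    (m : MonomialOrder (Fin n)) (f : MvPolynomial (Fin n) K) (hf : f ≠ 0) : Fin n →₀ ℕ :=
  m.toSyn.symm (f.support.sup' (MvPolynomial.support_nonempty.mpr hf) m.toSyn)

/-- The set of leading monomials of the nonzero elements of a set of polynomials. -/
noncomputable def lmSet {K : Type*} [Field K] {n : ℕ}
    (m : MonomialOrder (Fin n)) (S : Set (MvPolynomial (Fin n) K)) : Set (Fin n →₀ ℕ) :=
  {μ | ∃ (f : MvPolynomial (Fin n) K) (hf : f ≠ 0), f ∈ S ∧ leadingMonomial m f hf = μ}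

theorem leadingMonomial_eq_degree {K : Type*} [Field K] {n : ℕ}
    (m : MonomialOrder (Fin n)) (f : MvPolynomial (Fin n) K) (hf : f ≠ 0) :
    leadingMonomial m f hf = m.degree f := by
  simp [leadingMonomial, MonomialOrder.degree, Finset.sup'_eq_sup]

theorem mem_lmSet_iff {K : Type*} [Field K] {n : ℕ} {m : MonomialOrder (Fin n)}
    {S : Set (MvPolynomial (Fin n) K)} {μ : Fin n →₀ ℕ} :
    μ ∈ lmSet m S ↔ ∃ f ∈ S, f ≠ 0 ∧ m.degree f = μ := by
  simp only [lmSet, Set.mem_ofPred_eq, leadingMonomial_eq_degree]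
  exact ⟨fun ⟨f, hf, hS, h⟩ => ⟨f, hS, hf, h⟩, fun ⟨f, hS, hf, h⟩ => ⟨f, hf, hS, h⟩⟩

/-- A polynomial with support bounded by `d` and nonzero coefficient at `d` has degree `d`. -/
theorem MonomialOrder.degree_eq_of_le_of_coeff_ne_zero {σ R : Type*} [CommSemiring R]
    {m : MonomialOrder σ} {f : MvPolynomial σ R} {d : σ →₀ ℕ}
    (hle : m.toSyn (m.degree f) ≤ m.toSyn d) (hd : f.coeff d ≠ 0) : m.degree f = d :=
  m.toSyn.injective (le_antisymm hle (m.le_degree (MvPolynomial.mem_support_iff.mpr hd)))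

/-- Cancelling leading terms of equal degree gives zero or strictly lowers the degree. -/
theorem MonomialOrder.exists_sub_smul_eq_zero_or_degree_lt {σ K : Type*} [Field K]
    (m : MonomialOrder σ) {f g : MvPolynomial σ K} (hg : g ≠ 0)
    (h : m.degree g = m.degree f) :
    ∃ c : K, f - c • g = 0 ∨ m.toSyn (m.degree (f - c • g)) < m.toSyn (m.degree f) := by
  refine ⟨m.leadingCoeff f / m.leadingCoeff g, or_iff_not_imp_left.mpr fun hne => ?_⟩
  have hlc : m.leadingCoeff g ≠ 0 := m.leadingCoeff_ne_zero_iff.mpr hg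
  set p := f - (m.leadingCoeff f / m.leadingCoeff g) • g with hp
  have hle : m.toSyn (m.degree p) ≤ m.toSyn (m.degree f) := by
    refine m.degree_sub_le.trans (sup_le le_rfl ?_)
    rw [← h]
    exact m.degree_smul_le
  have hcoeff : p.coeff (m.degree f) = 0 := by
    have hgf : g.coeff (m.degree f) = m.leadingCoeff g := by
      rw [← h, MonomialOrder.leadingCoeff]
    rw [hp, MvPolynomial.coeff_sub, MvPolynomial.coeff_smul, hgf, smul_eq_mul,
      div_mul_cancel₀ _ hlc, MonomialOrder.leadingCoeff, sub_self]
  refine lt_of_le_of_ne hle fun heq => ?_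
  rw [← m.toSyn.injective heq] at hcoeff
  exact m.coeff_degree_ne_zero_iff.mpr hne hcoeff

/-- A nontrivial linear combination of nonzero polynomials with pairwise distinct degrees is
nonzero, and its degree is the degree of one of them. -/
theorem MonomialOrder.exists_degree_sum_smul_eq {σ K ι : Type*} [Field K]
    (m : MonomialOrder σ) {f : ι → MvPolynomial σ K} (hf : ∀ i, f i ≠ 0)
    (hinj : Function.Injective fun i => m.degree (f i)) (s : Finset ι) (c : ι → K)
    (hc : ∃ i ∈ s, c i ≠ 0) :
    ∃ j, ∑ i ∈ s, c i • f i ≠ 0 ∧ m.degree (∑ i ∈ s, c i • f i) = m.degree (f j) := by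
  classical
  obtain ⟨i₀, hi₀, hci₀⟩ := hc
  obtain ⟨j, hj, hmax⟩ := (s.filter (c · ≠ 0)).exists_max_image
    (fun i => m.toSyn (m.degree (f i))) ⟨i₀, by simp [hi₀, hci₀]⟩
  rw [Finset.mem_filter] at hj
  have hcoeff : (∑ i ∈ s, c i • f i).coeff (m.degree (f j)) ≠ 0 := by
    rw [MvPolynomial.coeff_sum, Finset.sum_eq_single_of_mem j hj.1]
    · rw [MvPolynomial.coeff_smul, smul_eq_mul]
      exact mul_ne_zero hj.2 (m.coeff_degree_ne_zero_iff.mpr (hf j))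
    · intro i hi hij
      by_cases hci : c i = 0
      · simp [hci]
      · have hlt : m.toSyn (m.degree (f i)) < m.toSyn (m.degree (f j)) :=
          lt_of_le_of_ne (hmax i (by simp [hi, hci]))
            fun h => hij (hinj (m.toSyn.injective h))
        rw [MvPolynomial.coeff_smul, m.coeff_eq_zero_of_lt hlt, smul_zero]
  refine ⟨j, fun h => hcoeff (by rw [h, MvPolynomial.coeff_zero]),
    m.degree_eq_of_le_of_coeff_ne_zero ?_ hcoeff⟩
  refine m.degree_sum_le.trans (Finset.sup_le fun i hi => ?_)
  by_cases hci : c i = 0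
  · simp [hci]
  · exact m.degree_smul_le.trans (hmax i (by simp [hi, hci]))

/-- If every leading monomial of the subspace `A` is attained by a nonzero element of `C ≤ A`,
then `A ≤ C`. -/
theorem le_of_lmSet_subset {K : Type*} [Field K] {n : ℕ} (m : MonomialOrder (Fin n))
    {A C : Submodule K (MvPolynomial (Fin n) K)} (hCA : C ≤ A)
    (h : lmSet m (A : Set (MvPolynomial (Fin n) K)) ⊆
      lmSet m (C : Set (MvPolynomial (Fin n) K))) : A ≤ C := by
  suffices H : ∀ d : m.syn, ∀ f ∈ A, m.toSyn (m.degree f) = d → f ∈ C from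
    fun f hf => H _ f hf rfl
  intro d
  induction d using WellFoundedLT.induction with
  | ind d ih =>
    rintro f hf rfl
    by_cases hf0 : f = 0
    · exact hf0 ▸ C.zero_mem
    obtain ⟨g, hg, hg0, hgf⟩ := mem_lmSet_iff.mp (h (mem_lmSet_iff.mpr ⟨f, hf, hf0, rfl⟩))
    obtain ⟨c, hc⟩ := m.exists_sub_smul_eq_zero_or_degree_lt hg0 hgf
    have hmem : f - c • g ∈ C := by
      rcases hc with hc | hc
      · exact hc ▸ C.zero_mem
      · exact ih _ hc _ (A.sub_mem hf (A.smul_mem c (hCA hg))) rfl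
    simpa using C.add_mem hmem (C.smul_mem c hg)

/-- For `K`-subspaces `B ⊆ A ⊆ K[x]` with `A/B` finite dimensional,
`dim(A/B)` equals the number of leading monomials of `A` that are not leading monomials
of `B` (with respect to any fixed monomial order). -/
theorem stmt_12 {K : Type*} [Field K] {n : ℕ}
    (m : MonomialOrder (Fin n))
    (A B : Submodule K (MvPolynomial (Fin n) K)) (hBA : B ≤ A)
    [FiniteDimensional K (A ⧸ Submodule.comap A.subtype B)] :
    Module.finrank K (A ⧸ Submodule.comap A.subtype B) =
      (lmSet m (A : Set (MvPolynomial (Fin n) K)) \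
        lmSet m (B : Set (MvPolynomial (Fin n) K))).ncard := by
  set L := lmSet m (A : Set (MvPolynomial (Fin n) K)) \
    lmSet m (B : Set (MvPolynomial (Fin n) K)) with hL
  have hex : ∀ μ : L, ∃ f ∈ A, f ≠ 0 ∧ m.degree f = μ := fun μ => mem_lmSet_iff.mp μ.2.1
  choose f hfA hf0 hfdeg using hex
  let w : L → A := fun μ => ⟨f μ, hfA μ⟩
  let q := (Submodule.comap A.subtype B).mkQ
  have hli : LinearIndependent K (q ∘ w) := by
    rw [linearIndependent_iff']
    intro s c hsum
    by_contra! hc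
    have hinj : Function.Injective fun μ : L => m.degree (f μ) := by
      intro μ ν h
      exact Subtype.ext (by simpa only [hfdeg] using h)
    obtain ⟨μ, hne, hdeg⟩ := m.exists_degree_sum_smul_eq hf0 hinj s c hc
    have hB : ∑ i ∈ s, c i • f i ∈ B := by
      have hker : q (∑ i ∈ s, c i • w i) = 0 := by simpa using hsum
      have := (Submodule.Quotient.mk_eq_zero _).mp hker
      simpa [w] using this
    exact μ.2.2 (mem_lmSet_iff.mpr ⟨_, hB, hne, hdeg.trans (hfdeg μ)⟩)
  have hA : A ≤ B ⊔ Submodule.span K (Set.range f) := by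
    refine le_of_lmSet_subset m
      (sup_le hBA (Submodule.span_le.mpr (Set.range_subset_iff.mpr hfA))) fun μ hμ => ?_
    by_cases hμB : μ ∈ lmSet m (B : Set (MvPolynomial (Fin n) K))
    · obtain ⟨g, hg, hg'⟩ := mem_lmSet_iff.mp hμB
      exact mem_lmSet_iff.mpr ⟨g, Submodule.mem_sup_left hg, hg'⟩
    · exact mem_lmSet_iff.mpr ⟨f ⟨μ, hμ, hμB⟩,
        Submodule.mem_sup_right (Submodule.subset_span ⟨_, rfl⟩), hf0 _, hfdeg _⟩
  have hspan : ⊤ ≤ Submodule.span K (Set.range (q ∘ w)) := by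
    rintro x -
    obtain ⟨a, rfl⟩ := Submodule.mkQ_surjective _ x
    obtain ⟨b, hb, y, hy, hab⟩ := Submodule.mem_sup.mp (hA a.2)
    have hrange : Set.range f = A.subtype '' Set.range w := by
      rw [← Set.range_comp]
      rfl
    rw [hrange, Submodule.span_image] at hy
    obtain ⟨z, hz, rfl⟩ := hy
    have haz : q a = q z := by
      refine (Submodule.Quotient.eq _).mpr ?_
      have : (a : MvPolynomial (Fin n) K) - z = b := by
        rw [← hab]
        simp
      simpa [this] using hb
    rw [Set.range_comp, Submodule.span_image]
    exact ⟨z, hz, haz.symm⟩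
  rw [Module.finrank_eq_nat_card_basis (Module.Basis.mk hli hspan), Nat.card_coe_set_eq]
end

section
/- Let A ⊆ K[x] be a subalgebra of finite codimension, let α, β, γ ∈ Kⁿ with γ not equivalent in A to α and γ not equivalent in A to β (i.e., there exist h₁, h₂ ∈ A with h₁(γ) ≠ h₁(α) and h₂(γ) ≠ h₂(β)). Let L : A → K be a K-linear map satisfying L(fg) = f(α)·L(g) + g(β)·L(f) for all f, g ∈ A, and set A' = A ∩ ker(L). Then every γ-derivation on A' is the restriction to A' of a γ-derivation on A; that is, for every K-linear D' : A' → K with D'(fg) = f(γ)·D'(g) + D'(f)·g(γ) for all f, g ∈ A', there exists a K-linear D : A → K with D(fg) = f(γ)·D(g) + D(f)·g(γ) for all f, g ∈ A such that D(f) = D'(f) for all f ∈ A'. -/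
set_option synthInstance.maxHeartbeats 1000000
set_option maxHeartbeats 1000000

open MvPolynomial

/-- A character `c` that differs from the character `a` takes the value `1` at some point of the
kernel of `a`. -/
theorem AlgHom.exists_eq_zero_and_eq_one_of_ne {K A : Type*} [Field K] [CommRing A] [Algebra K A]
    (a c : A →ₐ[K] K) (h : ∃ x, c x ≠ a x) : ∃ x, a x = 0 ∧ c x = 1 := by
  obtain ⟨x, hx⟩ := h
  refine ⟨(c x - a x)⁻¹ • (x - algebraMap K A (a x)), ?_, ?_⟩
  · simp
  · simp [inv_mul_cancel₀ (sub_ne_zero.mpr hx)]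

/-- If `h` multiplies an algebra `A` into a subspace `S` containing `h`, and the character `c`
takes the value `1` at `h`, then every `c`-derivation on `S` extends to a `c`-derivation on `A`. -/
theorem exists_pointDerivation_extension {K A : Type*} [Field K] [CommRing A] [Algebra K A]
    (c : A →ₐ[K] K) (S : Submodule K A) (h : A) (hS : ∀ f, h * f ∈ S) (hc : c h = 1)
    (D' : S →ₗ[K] K)
    (hD' : ∀ f g : S, ∀ hfg : (f : A) * g ∈ S, D' ⟨f * g, hfg⟩ = c f * D' g + D' f * c g) :
    ∃ D : A →ₗ[K] K, (∀ f g, D (f * g) = c f * D g + D f * c g) ∧ ∀ f : S, D f = D' f := by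
  have h_mem : h ∈ S := by simpa using hS 1
  let M : A →ₗ[K] S := (LinearMap.mulLeft K h).codRestrict S hS
  have hM (f : A) : (M f : A) = h * f := rfl
  have hcM (f : A) : c (M f) = c f := by simp [hM, hc]
  refine ⟨D' ∘ₗ M - D' ⟨h, h_mem⟩ • c.toLinearMap, fun f g => ?_, fun f => ?_⟩
  · have h_eq : (M f : A) * M g = h * M (f * g) := by simp only [hM]; ring
    have h₁ := hD' ⟨h, h_mem⟩ (M (f * g)) (hS _)
    have h₂ := hD' (M f) (M g) (h_eq ▸ hS _)
    simp only [h_eq, hcM, hc, map_mul, one_mul] at h₁ h₂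
    simp only [LinearMap.sub_apply, LinearMap.comp_apply, LinearMap.smul_apply, smul_eq_mul,
      AlgHom.toLinearMap_apply, map_mul]
    linear_combination h₂ - h₁
  · have h₁ : D' (M f) = _ := hD' ⟨h, h_mem⟩ f (hS _)
    simp only [LinearMap.sub_apply, LinearMap.comp_apply, LinearMap.smul_apply, smul_eq_mul,
      AlgHom.toLinearMap_apply, h₁, hc]
    ring

/-- Let `L` be an `α,β`-subalgebra condition on a finite-codimension
subalgebra `A ⊆ K[x]` where `γ` is equivalent to neither `α` nor `β` in `A`, and let
`A' = A ∩ ker L`. Then every `γ`-derivation on `A'` extends to a `γ`-derivation on `A`. -/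
theorem stmt_13 {K : Type*} [Field K] [IsAlgClosed K] [CharZero K] {n : ℕ}
    (A : Subalgebra K (MvPolynomial (Fin n) K))
    [FiniteDimensional K (MvPolynomial (Fin n) K ⧸ Subalgebra.toSubmodule A)]
    (α β γ : Fin n → K)
    (hγα : ∃ h : A, eval γ (h : MvPolynomial (Fin n) K) ≠ eval α (h : MvPolynomial (Fin n) K))
    (hγβ : ∃ h : A, eval γ (h : MvPolynomial (Fin n) K) ≠ eval β (h : MvPolynomial (Fin n) K))
    (L : A →ₗ[K] K)
    (hL : ∀ f g : A, L (f * g) =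
      eval α (f : MvPolynomial (Fin n) K) * L g + eval β (g : MvPolynomial (Fin n) K) * L f)
    (D' : LinearMap.ker L →ₗ[K] K)
    (hD' : ∀ f g : LinearMap.ker L, ∀ hfg : ((f : A) * (g : A)) ∈ LinearMap.ker L,
      D' ⟨(f : A) * (g : A), hfg⟩ =
        eval γ ((f : A) : MvPolynomial (Fin n) K) * D' g +
          D' f * eval γ ((g : A) : MvPolynomial (Fin n) K)) :
    ∃ D : A →ₗ[K] K,
      (∀ f g : A, D (f * g) =
        eval γ (f : MvPolynomial (Fin n) K) * D g + D f * eval γ (g : MvPolynomial (Fin n) K)) ∧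
      ∀ f : LinearMap.ker L, D (f : A) = D' f := by
  let ev (p : Fin n → K) : A →ₐ[K] K := (aeval p).comp A.val
  have hev (p : Fin n → K) (f : A) : ev p f = eval p (f : MvPolynomial (Fin n) K) := by
    simp [ev, aeval_eq_eval]
  simp only [← hev] at hγα hγβ hL hD' ⊢
  obtain ⟨u, huα, huγ⟩ := AlgHom.exists_eq_zero_and_eq_one_of_ne _ _ hγα
  obtain ⟨v, hvβ, hvγ⟩ := AlgHom.exists_eq_zero_and_eq_one_of_ne _ _ hγβ
  refine exists_pointDerivation_extension (ev γ) _ (u * v) (fun f => ?_) (by simp [huγ, hvγ]) D' hD'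
  simp [hL, huα, hvβ]
end

section
/- Let A ⊆ K[x] be a subalgebra of finite codimension and let α ∈ Kⁿ be a point not in the subalgebra spectrum Sp(A). Then every α-derivation D on A is a linear combination of partial derivative evaluations at α: there exist scalars c₁, …, cₙ ∈ K such that D(f) = Σ_{i=1}^n c_i·(∂f/∂x_i)(α) for all f ∈ A. -/
set_option synthInstance.maxHeartbeats 1000000
set_option maxHeartbeats 1000000

open MvPolynomial

namespace MvPolynomial

variable {K : Type*} [Field K] {n : ℕ}

/-- First-order Taylor expansion: the remainder lies in the square of the ideal of the point. -/
theorem sub_taylor_one_mem_ker_eval_sq (α : Fin n → K) (h : MvPolynomial (Fin n) K) :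
    h - C (eval α h) - ∑ i, C (eval α (pderiv i h)) * (X i - C (α i)) ∈
      (RingHom.ker (eval α)) ^ 2 := by
  have hX (i : Fin n) : (X i - C (α i) : MvPolynomial (Fin n) K) ∈ RingHom.ker (eval α) := by
    simp [RingHom.mem_ker]
  induction h using MvPolynomial.induction_on with
  | C a => simp
  | add p q hp hq =>
    convert add_mem hp hq using 1
    simp only [map_add, add_mul, Finset.sum_add_distrib]
    ring
  | mul_X p j hp =>
    have hsum : (∑ i, C (eval α (pderiv i p)) * (X i - C (α i))) * (X j - C (α j)) ∈
        (RingHom.ker (eval α)) ^ 2 := by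
      rw [pow_two]
      exact Ideal.mul_mem_mul (sum_mem fun i _ => Ideal.mul_mem_left _ _ (hX i)) (hX j)
    convert add_mem (Ideal.mul_mem_right (X j) _ hp) hsum using 1
    have hder : ∑ i, C (eval α (pderiv i (p * X j))) * (X i - C (α i)) =
        C (eval α p) * (X j - C (α j)) +
          C (α j) * ∑ i, C (eval α (pderiv i p)) * (X i - C (α i)) := by
      simp only [Derivation.leibniz, pderiv_X, smul_eq_mul, map_add, map_mul, eval_X, add_mul,
        Finset.sum_add_distrib, Finset.mul_sum]
      congr 1
      · rw [Finset.sum_eq_single j]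
        · simp
        · intro b _ hb
          simp [Pi.single_eq_of_ne hb.symm]
        · simp
      · exact Finset.sum_congr rfl fun i _ => by ring
    rw [hder]
    simp only [map_mul, eval_X]
    ring

/-- A point derivation on the polynomial ring is determined by its values on the variables. -/
theorem pointDerivation_eq_sum_s14 (α : Fin n → K) (E : MvPolynomial (Fin n) K →ₗ[K] K)
    (hE : ∀ p q, E (p * q) = eval α p * E q + E p * eval α q) (h : MvPolynomial (Fin n) K) :
    E h = ∑ i, E (X i) * eval α (pderiv i h) := by
  have hC (a : K) : E (C a) = 0 := by
    have h1 : E 1 = 0 := by simpa using hE 1 1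
    rw [← mul_one (C a), ← smul_eq_C_mul, map_smul, h1, smul_zero]
  induction h using MvPolynomial.induction_on with
  | C a => simp [hC]
  | add p q hp hq => simp [hp, hq, mul_add, Finset.sum_add_distrib]
  | mul_X p j hp =>
    rw [hE, hp]
    simp only [Derivation.leibniz, pderiv_X, smul_eq_mul, map_add, map_mul, eval_X, mul_add,
      Finset.sum_add_distrib, Finset.sum_mul]
    congr 1
    · rw [Finset.sum_eq_single j]
      · simp [mul_comm]
      · intro b _ hb
        simp [Pi.single_eq_of_ne hb.symm]
      · simp
    · exact Finset.sum_congr rfl fun i _ => by ring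

/-- If no nonzero direction at `α` is annihilated by all elements of `A`, then every gradient at
`α` is the gradient of an element of `A`. -/
theorem exists_mem_pderiv_eq (A : Subalgebra K (MvPolynomial (Fin n) K)) (α : Fin n → K)
    (hα : ∀ u : Fin n → K, (∀ f ∈ A, ∑ i, u i * eval α (pderiv i f) = 0) → u = 0)
    (v : Fin n → K) : ∃ f ∈ A, ∀ i, eval α (pderiv i f) = v i := by
  let grad : MvPolynomial (Fin n) K →ₗ[K] (Fin n → K) :=
    LinearMap.pi fun i => (aeval α).toLinearMap ∘ₗ (pderiv i).toLinearMap
  have hgrad (f i) : grad f i = eval α (pderiv i f) := rfl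
  have htop : (Subalgebra.toSubmodule A).map grad = ⊤ := by
    by_contra hne
    obtain ⟨φ, hφ, hle⟩ := Submodule.exists_le_ker_of_lt_top _ (lt_top_iff_ne_top.2 hne)
    have hφu (w : Fin n → K) : φ w = ∑ i, φ (Pi.single i 1) * w i := by
      conv_lhs => rw [pi_eq_sum_univ' w]
      simp [mul_comm]
    have hu := hα (fun i => φ (Pi.single i 1)) fun f hf => by
      have : φ (grad f) = 0 := hle ⟨f, hf, rfl⟩
      rwa [hφu] at this
    refine hφ (LinearMap.ext fun w => ?_)
    rw [hφu]
    simp [fun i => congrFun hu i]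
  obtain ⟨f, hf, hfv⟩ : v ∈ (Subalgebra.toSubmodule A).map grad := htop ▸ Submodule.mem_top
  exact ⟨f, hf, fun i => by rw [← hgrad, hfv]⟩

/-- If `A` separates `α` from all other points and from all tangent directions, then
the functions of `A` vanishing at `α` generate the maximal ideal of `α`. -/
theorem map_ker_eval_eq [IsAlgClosed K] (A : Subalgebra K (MvPolynomial (Fin n) K))
    (α : Fin n → K)
    (hu : ∀ u : Fin n → K, (∀ f ∈ A, ∑ i, u i * eval α (pderiv i f) = 0) → u = 0)
    (hβ : ∀ β : Fin n → K, (∀ f ∈ A, eval α f = eval β f) → β = α) :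
    ((RingHom.ker (eval α)).comap (algebraMap A (MvPolynomial (Fin n) K))).map
      (algebraMap A (MvPolynomial (Fin n) K)) = RingHom.ker (eval α) := by
  set m := RingHom.ker (eval α)
  set J := (m.comap (algebraMap A (MvPolynomial (Fin n) K))).map
    (algebraMap A (MvPolynomial (Fin n) K))
  have hJm : J ≤ m := Ideal.map_comap_le
  have hmemJ : ∀ f ∈ A, f - C (eval α f) ∈ J := fun f hf => by
    have hfA : f - C (eval α f) ∈ A := sub_mem hf (A.algebraMap_mem _)
    have hfm : f - C (eval α f) ∈ m := by simp [m, RingHom.mem_ker]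
    exact Ideal.mem_map_of_mem (algebraMap A (MvPolynomial (Fin n) K)) (x := ⟨_, hfA⟩)
      (I := m.comap (algebraMap A (MvPolynomial (Fin n) K))) hfm
  have hrad : m ≤ J.radical := by
    rw [← vanishingIdeal_zeroLocus_eq_radical (K := K)]
    intro p hp β hmem
    have : β = α := hβ β fun f hf => by
      have := hmem _ (hmemJ f hf)
      simp only [map_sub, aeval_C] at this
      exact (sub_eq_zero.1 this).symm
    subst this
    exact hp
  have hsq : m ≤ J ⊔ m ^ 2 := fun h hh => by
    obtain ⟨f, hf, hfd⟩ := exists_mem_pderiv_eq A α hu fun i => eval α (pderiv i h)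
    have hg := hmemJ f hf
    have key := sub_taylor_one_mem_ker_eval_sq α (h - (f - C (eval α f)))
    have hh0 : eval α h = 0 := hh
    simp only [map_sub, hfd, pderiv_C, hh0, eval_C, sub_self, map_zero, sub_zero, zero_mul,
      Finset.sum_const_zero] at key
    exact Submodule.mem_sup.2 ⟨_, hg, _, key, by ring⟩
  have hpow (k : ℕ) : m ≤ J ⊔ m ^ (k + 1) := by
    induction k with
    | zero => simp
    | succ k ih =>
      refine hsq.trans (sup_le le_sup_left ?_)
      calc m ^ 2 = m * m := pow_two m
        _ ≤ (J ⊔ m ^ (k + 1)) * m := Ideal.mul_mono_left ih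
        _ = J * m ⊔ m ^ (k + 1 + 1) := by rw [Ideal.sup_mul, pow_succ m (k + 1)]
        _ ≤ J ⊔ m ^ (k + 1 + 1) := sup_le_sup_right Ideal.mul_le_left _
  obtain ⟨k, hk⟩ := Ideal.exists_pow_le_of_le_radical_of_fg hrad (IsNoetherian.noetherian m)
  exact le_antisymm hJm
    ((hpow k).trans (sup_le le_rfl ((Ideal.pow_le_pow_right (Nat.le_succ k)).trans hk)))

/-- At a point where `A` generates the maximal ideal, the conductor of a subalgebra
of finite codimension contains a function which is nonzero at that point. -/
theorem exists_conductor_eval_ne_zero (A : Subalgebra K (MvPolynomial (Fin n) K))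
    [FiniteDimensional K (MvPolynomial (Fin n) K ⧸ Subalgebra.toSubmodule A)] (α : Fin n → K)
    (hmap : ((RingHom.ker (eval α)).comap (algebraMap A (MvPolynomial (Fin n) K))).map
      (algebraMap A (MvPolynomial (Fin n) K)) = RingHom.ker (eval α)) :
    ∃ f ∈ A, eval α f ≠ 0 ∧ ∀ r, f * r ∈ A := by
  set I := (RingHom.ker (eval α)).comap (algebraMap A (MvPolynomial (Fin n) K))
  let P : Submodule A (MvPolynomial (Fin n) K) := LinearMap.range (Algebra.linearMap A _)
  have hP (r) : r ∈ P ↔ r ∈ A :=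
    ⟨fun ⟨a, ha⟩ => ha ▸ a.2, fun hr => ⟨⟨r, hr⟩, rfl⟩⟩
  let φ : (MvPolynomial (Fin n) K ⧸ Subalgebra.toSubmodule A) →ₗ[K]
      (MvPolynomial (Fin n) K ⧸ P) :=
    (Subalgebra.toSubmodule A).liftQ (P.mkQ.restrictScalars K) fun r hr => by
      simpa [hP] using hr
  have hφ : Function.Surjective φ := fun y => by
    obtain ⟨r, rfl⟩ := P.mkQ_surjective y
    exact ⟨Submodule.Quotient.mk r, rfl⟩
  have : Module.Finite K (MvPolynomial (Fin n) K ⧸ P) := Module.Finite.of_surjective φ hφ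
  have : Module.Finite A (MvPolynomial (Fin n) K ⧸ P) :=
    Module.Finite.of_restrictScalars_finite K A _
  have htop : (⊤ : Submodule A (MvPolynomial (Fin n) K ⧸ P)) ≤ I • ⊤ := by
    rintro y -
    obtain ⟨r, rfl⟩ := P.mkQ_surjective y
    have hr : r - C (eval α r) ∈ (I • ⊤ : Submodule A (MvPolynomial (Fin n) K)) := by
      rw [Ideal.smul_top_eq_map, Submodule.restrictScalars_mem, hmap]
      simp [RingHom.mem_ker]
    have hmem := Submodule.mem_map_of_mem (f := P.mkQ) hr
    have hC : P.mkQ (C (eval α r)) = 0 := by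
      simpa [hP] using A.algebraMap_mem (eval α r)
    rw [Submodule.map_smul'', map_sub, hC, sub_zero] at hmem
    exact Submodule.smul_mono le_rfl le_top hmem
  obtain ⟨a, ha, hkill⟩ := Submodule.exists_sub_one_mem_and_smul_eq_zero_of_fg_of_le_smul I _
    Module.Finite.fg_top htop
  refine ⟨a, a.2, ?_, fun r => ?_⟩
  · have : eval α ((a : MvPolynomial (Fin n) K) - 1) = 0 := ha
    rw [map_sub, map_one, sub_eq_zero] at this
    simp [this]
  · have := hkill (P.mkQ r) trivial
    rw [← map_smul, Submodule.mkQ_apply, Submodule.Quotient.mk_eq_zero, hP] at this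
    exact this

/-- A point derivation on `A` extends to the polynomial ring when the conductor of `A` contains a
function which is nonzero at the point. -/
theorem exists_pointDerivation_extension (A : Subalgebra K (MvPolynomial (Fin n) K))
    (α : Fin n → K) {f : MvPolynomial (Fin n) K} (hfA : f ∈ A) (hf : eval α f ≠ 0)
    (hcond : ∀ r, f * r ∈ A) (D : A →ₗ[K] K)
    (hD : ∀ f g : A, D (f * g) =
      eval α (f : MvPolynomial (Fin n) K) * D g + D f * eval α (g : MvPolynomial (Fin n) K)) :
    ∃ E : MvPolynomial (Fin n) K →ₗ[K] K,
      (∀ p q, E (p * q) = eval α p * E q + E p * eval α q) ∧ ∀ a : A, E a = D a := by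
  let μ : MvPolynomial (Fin n) K →ₗ[K] A :=
    (LinearMap.mulLeft K f).codRestrict (Subalgebra.toSubmodule A) hcond
  have hμ (r) : (μ r : MvPolynomial (Fin n) K) = f * r := rfl
  let E : MvPolynomial (Fin n) K →ₗ[K] K :=
    (eval α f)⁻¹ • (D ∘ₗ μ - D ⟨f, hfA⟩ • (aeval α).toLinearMap)
  have hE (r) : E r = (eval α f)⁻¹ * (D (μ r) - D ⟨f, hfA⟩ * eval α r) := rfl
  refine ⟨E, fun p q => ?_, fun a => ?_⟩
  · have h₁ := hD (μ p) (μ q)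
    have h₂ := hD ⟨f, hfA⟩ (μ (p * q))
    have h₃ : μ p * μ q = ⟨f, hfA⟩ * μ (p * q) := Subtype.ext (by
      simp only [MulMemClass.coe_mul, hμ]
      ring)
    rw [← h₃, h₁] at h₂
    simp only [hμ, map_mul] at h₂
    simp only [hE, map_mul]
    field_simp
    refine mul_left_cancel₀ hf ?_
    linear_combination -h₂
  · have h₁ : μ a = ⟨f, hfA⟩ * a := rfl
    rw [hE, h₁, hD]
    field_simp
    ring

end MvPolynomial

/-- If `α` lies outside the subalgebra spectrum of a finite-codimension
subalgebra `A ⊆ K[x]`, then every `α`-derivation on `A` is a linear combination of the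
first-order partial-derivative evaluations `f ↦ (∂f/∂xᵢ)(α)`. -/
theorem stmt_14 {K : Type*} [Field K] [IsAlgClosed K] [CharZero K] {n : ℕ}
    (A : Subalgebra K (MvPolynomial (Fin n) K))
    [FiniteDimensional K (MvPolynomial (Fin n) K ⧸ Subalgebra.toSubmodule A)]
    (α : Fin n → K)
    (hα : ¬ ((∃ u : Fin n → K, u ≠ 0 ∧
          ∀ f ∈ A, ∑ i : Fin n, u i * eval α (pderiv i f) = 0) ∨
        (∃ β : Fin n → K, β ≠ α ∧ ∀ f ∈ A, eval α f = eval β f)))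
    (D : A →ₗ[K] K)
    (hD : ∀ f g : A, D (f * g) =
      eval α (f : MvPolynomial (Fin n) K) * D g + D f * eval α (g : MvPolynomial (Fin n) K)) :
    ∃ c : Fin n → K, ∀ f : A,
      D f = ∑ i : Fin n, c i * eval α (pderiv i (f : MvPolynomial (Fin n) K)) := by
  obtain ⟨hu, hβ⟩ := not_or.1 hα
  have hmap := map_ker_eval_eq A α
    (fun u h => by_contra fun hne => hu ⟨u, hne, h⟩)
    (fun β h => by_contra fun hne => hβ ⟨β, hne, h⟩)
  obtain ⟨f, hfA, hf, hcond⟩ := exists_conductor_eval_ne_zero A α hmap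
  obtain ⟨E, hE, hED⟩ := exists_pointDerivation_extension A α hfA hf hcond D hD
  exact ⟨fun i => E (X i), fun a => by rw [← hED, pointDerivation_eq_sum_s14 α E hE]⟩
end

section
/- Let B ⊆ K[x] be a subalgebra of finite codimension, let α, β ∈ Kⁿ (possibly equal), and let L : B → K be a nonzero K-linear map satisfying L(fg) = f(α)·L(g) + g(β)·L(f) for all f, g ∈ B. Set A = ker(L). Then Sp(A) = {α, β} ∪ Sp(B). -/
set_option synthInstance.maxHeartbeats 1000000
set_option maxHeartbeats 1000000

open MvPolynomial

/-- The subalgebra spectrum of a set `S` of polynomials: points `α` such that either some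
nonzero directional derivative at `α` annihilates all of `S`, or `S` does not separate
`α` from some other point `β`. -/
def subalgSpectrum {K : Type*} [Field K] {n : ℕ}
    (S : Set (MvPolynomial (Fin n) K)) : Set (Fin n → K) :=
  {α | (∃ u : Fin n → K, u ≠ 0 ∧
          ∀ f ∈ S, ∑ i : Fin n, u i * eval α (pderiv i f) = 0) ∨
        (∃ β : Fin n → K, β ≠ α ∧ ∀ f ∈ S, eval α f = eval β f)}

/-- First-order Taylor expansion of a polynomial at `α`, with polynomial coefficients. -/
theorem MvPolynomial.exists_eq_C_eval_add_sum {K : Type*} [Field K] {n : ℕ} (α : Fin n → K)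
    (p : MvPolynomial (Fin n) K) :
    ∃ q : Fin n → MvPolynomial (Fin n) K,
      p = C (eval α p) + ∑ i, q i * (X i - C (α i)) := by
  set I : Ideal (MvPolynomial (Fin n) K) := Ideal.span (Set.range fun i => X i - C (α i)) with hI
  have key : ∀ p : MvPolynomial (Fin n) K, p - C (eval α p) ∈ I := by
    intro p
    induction p using MvPolynomial.induction_on with
    | C a => simp
    | add p q hp hq =>
      have := I.add_mem hp hq
      simp only [map_add]
      convert this using 1
      ring
    | mul_X p i hp =>
      have h1 : (X i - C (α i) : MvPolynomial (Fin n) K) ∈ I := Ideal.subset_span ⟨i, rfl⟩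
      have := I.add_mem (I.mul_mem_left p h1) (I.mul_mem_left (C (α i)) hp)
      simp only [map_mul, eval_X]
      convert this using 1
      ring
  obtain ⟨q, hq⟩ := Ideal.mem_span_range_iff_exists_fun.mp (key p)
  exact ⟨q, by rw [hq]; ring⟩

/-- A linear point derivation at `α` on the polynomial ring is a directional derivative. -/
theorem MvPolynomial.pointDerivation_eq_sum_pderiv {K : Type*} [Field K] {n : ℕ} (α : Fin n → K)
    (D : MvPolynomial (Fin n) K →ₗ[K] K)
    (hD : ∀ f g, D (f * g) = eval α f * D g + eval α g * D f) (p : MvPolynomial (Fin n) K) :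
    D p = ∑ i, D (X i) * eval α (pderiv i p) := by
  have h1 : D 1 = 0 := by
    have := hD 1 1
    simpa using this
  induction p using MvPolynomial.induction_on with
  | C a =>
    have : (C a : MvPolynomial (Fin n) K) = a • 1 := by rw [smul_eq_C_mul, mul_one]
    rw [this, map_smul, h1]
    simp
  | add p q hp hq => simp only [map_add, hp, hq, mul_add, Finset.sum_add_distrib]
  | mul_X p j hp =>
    have : ∀ i, D (X i) * eval α (pderiv i (p * X j)) =
        (if i = j then eval α p * D (X j) else 0) +
          α j * (D (X i) * eval α (pderiv i p)) := by
      intro i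
      rw [Derivation.leibniz, pderiv_X]
      by_cases h : i = j
      · subst h; simp; ring
      · simp [h, Ne.symm h]; ring
    rw [hD, Finset.sum_congr rfl fun i _ => this i, Finset.sum_add_distrib, ← Finset.mul_sum, ← hp]
    simp

theorem subalgSpectrum_anti {K : Type*} [Field K] {n : ℕ} {S T : Set (MvPolynomial (Fin n) K)}
    (h : S ⊆ T) : subalgSpectrum T ⊆ subalgSpectrum S := by
  rintro γ (⟨u, hu, hf⟩ | ⟨δ, hδ, hf⟩)
  · exact Or.inl ⟨u, hu, fun f hfS => hf f (h hfS)⟩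
  · exact Or.inr ⟨δ, hδ, fun f hfS => hf f (h hfS)⟩

/-- Outside the spectrum, every gradient at `α` is realized by an element of the subalgebra. -/
theorem exists_mem_forall_eval_pderiv_eq {K : Type*} [Field K] {n : ℕ}
    (B : Subalgebra K (MvPolynomial (Fin n) K)) {α : Fin n → K}
    (hα : α ∉ subalgSpectrum (B : Set (MvPolynomial (Fin n) K))) (v : Fin n → K) :
    ∃ f ∈ B, ∀ i, eval α (pderiv i f) = v i := by
  let G : MvPolynomial (Fin n) K →ₗ[K] (Fin n → K) :=
    LinearMap.pi fun i => (aeval α).toLinearMap ∘ₗ (pderiv i).toLinearMap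
  have hG : ∀ f i, G f i = eval α (pderiv i f) := fun f i => by
    simp [G, aeval_eq_eval]
  have htop : (Subalgebra.toSubmodule B).map G = ⊤ := by
    by_contra hne
    obtain ⟨φ, hφ, hle⟩ := Submodule.exists_le_ker_of_lt_top _ (lt_top_iff_ne_top.mpr hne)
    have hsum : ∀ w, φ w = ∑ i, φ (Pi.single i 1) * w i := fun w => by
      rw [LinearMap.pi_apply_eq_sum_univ φ w]
      refine Finset.sum_congr rfl fun i _ => ?_
      rw [smul_eq_mul, mul_comm]
      congr 2
      ext j
      simp [Pi.single_apply, eq_comm]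
    refine hα (Or.inl ⟨fun i => φ (Pi.single i 1), fun h0 => hφ ?_, fun f hf => ?_⟩)
    · ext w
      simp only [_root_.funext_iff, Pi.zero_apply] at h0
      simp [h0]
    · have : φ (G f) = 0 := hle ⟨f, hf, rfl⟩
      rw [hsum] at this
      simpa only [hG] using this
  obtain ⟨f, hf, hfv⟩ : v ∈ (Subalgebra.toSubmodule B).map G := htop ▸ Submodule.mem_top
  exact ⟨f, hf, fun i => by rw [← hG, hfv]⟩

/-- Outside the spectrum, the elements of the subalgebra vanishing at `α` generate the whole
maximal ideal of `α`. -/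
theorem mem_span_of_eval_eq_zero {K : Type*} [Field K] [IsAlgClosed K] {n : ℕ}
    (B : Subalgebra K (MvPolynomial (Fin n) K)) {α : Fin n → K}
    (hα : α ∉ subalgSpectrum (B : Set (MvPolynomial (Fin n) K)))
    {p : MvPolynomial (Fin n) K} (hp : eval α p = 0) :
    p ∈ Ideal.span {f : MvPolynomial (Fin n) K | f ∈ B ∧ eval α f = 0} := by
  set J := Ideal.span {f : MvPolynomial (Fin n) K | f ∈ B ∧ eval α f = 0} with hJ
  set m : Ideal (MvPolynomial (Fin n) K) := RingHom.ker (eval α) with hm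
  have hX : ∀ i, (X i - C (α i) : MvPolynomial (Fin n) K) ∈ m := fun i => by
    simp [hm, RingHom.mem_ker]
  have hsq : ∀ q ∈ m, (∀ i, eval α (pderiv i q) = 0) → q ∈ m ^ 2 := by
    intro q hq hd
    obtain ⟨r, hr⟩ := exists_eq_C_eval_add_sum α q
    rw [RingHom.mem_ker.mp hq, C_0, zero_add] at hr
    have hrm : ∀ j, r j ∈ m := by
      intro j
      have h := hd j
      rw [hr, map_sum, map_sum] at h
      have h2 : ∀ i, eval α (pderiv j (r i * (X i - C (α i)))) =
          if i = j then eval α (r j) else 0 := by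
        intro i
        rw [Derivation.leibniz]
        by_cases hij : i = j
        · subst hij; simp
        · simp [hij, pderiv_X]
      rw [Finset.sum_congr rfl fun i _ => h2 i] at h
      rw [hm, RingHom.mem_ker]
      simpa using h
    rw [hr, pow_two]
    exact Ideal.sum_mem _ fun i _ => Ideal.mul_mem_mul (hrm i) (hX i)
  have hXJ : ∀ i, (X i - C (α i) : MvPolynomial (Fin n) K) ∈ J ⊔ m ^ 2 := by
    intro i
    obtain ⟨f, hf, hfd⟩ := exists_mem_forall_eval_pderiv_eq B hα (Pi.single i 1)
    have hfJ : f - C (eval α f) ∈ J :=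
      Ideal.subset_span ⟨B.sub_mem hf (B.algebraMap_mem _), by simp⟩
    have h2 : (X i - C (α i)) - (f - C (eval α f)) ∈ m ^ 2 := by
      refine hsq _ (m.sub_mem (hX i) (by simp [hm, RingHom.mem_ker])) fun j => ?_
      simp only [map_sub, pderiv_C, hfd, pderiv_X, sub_zero]
      by_cases h : i = j
      · subst h; simp
      · simp [h, Ne.symm h]
    have := Submodule.add_mem_sup hfJ h2
    rwa [add_sub_cancel] at this
  have hle : m ≤ J ⊔ m ^ 2 := by
    intro q hq
    obtain ⟨r, hr⟩ := exists_eq_C_eval_add_sum α q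
    rw [RingHom.mem_ker.mp hq, C_0, zero_add] at hr
    rw [hr]
    exact Ideal.sum_mem _ fun i _ => Ideal.mul_mem_left _ _ (hXJ i)
  have hpow : ∀ k, m ≤ J ⊔ m ^ (k + 1) := by
    intro k
    induction k with
    | zero => simp
    | succ k ih =>
      have h1 : m ^ 2 ≤ J ⊔ m ^ (k + 1 + 1) := by
        rw [pow_two, pow_succ _ (k + 1)]
        refine (Ideal.mul_mono_left ih).trans ?_
        rw [Ideal.sup_mul]
        exact sup_le_sup_right Ideal.mul_le_left _
      exact hle.trans (sup_le le_sup_left h1)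
  have hrad : m ≤ J.radical := by
    rw [← vanishingIdeal_zeroLocus_eq_radical (K := K)]
    intro q hq γ hγ
    have hγα : γ = α := by
      by_contra hne
      refine hα (Or.inr ⟨γ, hne, fun f hf => ?_⟩)
      have := hγ (f - C (eval α f))
        (Ideal.subset_span ⟨B.sub_mem hf (B.algebraMap_mem _), by simp⟩)
      simp only [aeval_eq_eval, map_sub, eval_C] at this
      exact (sub_eq_zero.mp this).symm
    subst hγα
    simpa [hm, RingHom.mem_ker, aeval_eq_eval] using hq
  obtain ⟨N, hN⟩ := Ideal.exists_pow_le_of_le_radical_of_fg hrad (IsNoetherian.noetherian m)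
  have hmem : p ∈ J ⊔ m ^ (N + 1) := hpow N hp
  have : J ⊔ m ^ (N + 1) ≤ J := sup_le le_rfl ((Ideal.pow_le_pow_right N.le_succ).trans hN)
  exact this hmem

/-- Outside the spectrum of a finite-codimension subalgebra, some element of the conductor
does not vanish. -/
theorem exists_eval_eq_one_forall_mul_mem {K : Type*} [Field K] [IsAlgClosed K] {n : ℕ}
    (B : Subalgebra K (MvPolynomial (Fin n) K))
    [FiniteDimensional K (MvPolynomial (Fin n) K ⧸ Subalgebra.toSubmodule B)] {α : Fin n → K}
    (hα : α ∉ subalgSpectrum (B : Set (MvPolynomial (Fin n) K))) :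
    ∃ h : MvPolynomial (Fin n) K, eval α h = 1 ∧ ∀ p, h * p ∈ B := by
  let P : Submodule B (MvPolynomial (Fin n) K) :=
    LinearMap.range (Algebra.linearMap B (MvPolynomial (Fin n) K))
  have hP : ∀ p, p ∈ P ↔ p ∈ B := fun p =>
    ⟨fun ⟨b, hb⟩ => hb ▸ b.2, fun hp => ⟨⟨p, hp⟩, rfl⟩⟩
  have hPB : P.restrictScalars K = Subalgebra.toSubmodule B := by
    ext p
    exact hP p
  have : Module.Finite K (MvPolynomial (Fin n) K ⧸ P.restrictScalars K) := by
    rw [hPB]; infer_instance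
  have : Module.Finite K (MvPolynomial (Fin n) K ⧸ P) :=
    Module.Finite.equiv (Submodule.Quotient.restrictScalarsEquiv K P)
  have : Module.Finite B (MvPolynomial (Fin n) K ⧸ P) :=
    Module.Finite.of_restrictScalars_finite K B _
  let I : Ideal B := RingHom.ker ((eval α).comp B.val.toRingHom)
  have hI : ∀ b : B, b ∈ I ↔ eval α (b : MvPolynomial (Fin n) K) = 0 := fun b => Iff.rfl
  have hspan : ∀ q ∈ Ideal.span {f : MvPolynomial (Fin n) K | f ∈ B ∧ eval α f = 0},
      ∀ c, P.mkQ (c * q) ∈ I • (⊤ : Submodule B (MvPolynomial (Fin n) K ⧸ P)) := by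
    intro q hq
    induction hq using Submodule.span_induction with
    | mem f hf =>
      intro c
      have := Submodule.smul_mem_smul ((hI ⟨f, hf.1⟩).mpr hf.2)
        (Submodule.mem_top (x := P.mkQ c))
      rwa [← map_smul, Subalgebra.smul_def, smul_eq_mul, mul_comm] at this
    | zero => simp
    | add f g _ _ hf hg =>
      intro c
      rw [mul_add, map_add]
      exact Submodule.add_mem _ (hf c) (hg c)
    | smul a f _ hf =>
      intro c
      rw [smul_eq_mul, ← mul_assoc]
      exact hf (c * a)
  have hle : (⊤ : Submodule B (MvPolynomial (Fin n) K ⧸ P)) ≤ I • ⊤ := by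
    rintro x -
    obtain ⟨p, rfl⟩ := P.mkQ_surjective x
    have h1 : P.mkQ (C (eval α p)) = 0 := by
      rw [Submodule.mkQ_apply, Submodule.Quotient.mk_eq_zero, hP]
      exact B.algebraMap_mem _
    have h2 := hspan _ (mem_span_of_eval_eq_zero B hα (p := p - C (eval α p)) (by simp)) 1
    rwa [one_mul, map_sub, h1, sub_zero] at h2
  obtain ⟨r, hr, hr0⟩ := Submodule.exists_sub_one_mem_and_smul_eq_zero_of_fg_of_le_smul I ⊤
    Module.Finite.fg_top hle
  refine ⟨r, ?_, fun p => ?_⟩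
  · have := (hI _).mp hr
    simpa [sub_eq_zero] using this
  · have := hr0 (P.mkQ p) Submodule.mem_top
    rw [← map_smul, Submodule.mkQ_apply, Submodule.Quotient.mk_eq_zero, hP] at this
    exact this

/-- A nonzero point derivation of `B` at a point `α` puts `α` in the spectrum of its kernel. -/
theorem mem_subalgSpectrum_ker_of_pointDerivation {K : Type*} [Field K] [IsAlgClosed K] {n : ℕ}
    (B : Subalgebra K (MvPolynomial (Fin n) K))
    [FiniteDimensional K (MvPolynomial (Fin n) K ⧸ Subalgebra.toSubmodule B)]
    (α : Fin n → K) (L : B →ₗ[K] K) (hL : L ≠ 0)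
    (hLeib : ∀ f g : B, L (f * g) =
      eval α (f : MvPolynomial (Fin n) K) * L g + eval α (g : MvPolynomial (Fin n) K) * L f) :
    α ∈ subalgSpectrum {f : MvPolynomial (Fin n) K | ∃ hf : f ∈ B, L ⟨f, hf⟩ = 0} := by
  by_cases hα : α ∈ subalgSpectrum (B : Set (MvPolynomial (Fin n) K))
  · refine subalgSpectrum_anti ?_ hα
    rintro f ⟨hf, -⟩
    exact hf
  obtain ⟨h, h1, hmul⟩ := exists_eval_eq_one_forall_mul_mem B hα
  have hB : h ∈ B := by simpa using hmul 1
  let D : MvPolynomial (Fin n) K →ₗ[K] K :=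
    L ∘ₗ LinearMap.codRestrict (Subalgebra.toSubmodule B) (LinearMap.mulLeft K h) hmul -
      L ⟨h, hB⟩ • (aeval α).toLinearMap
  have hD : ∀ f, D f = L ⟨h * f, hmul f⟩ - L ⟨h, hB⟩ * eval α f := fun f => by
    simp only [D, LinearMap.sub_apply, LinearMap.comp_apply, LinearMap.smul_apply, smul_eq_mul,
      AlgHom.toLinearMap_apply]
    rfl
  have hDL : ∀ f : B, D f = L f := fun f => by
    have := hLeib ⟨h, hB⟩ f
    rw [hD]
    change L ⟨h * f, hmul f⟩ = _ at this
    rw [this, h1]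
    ring
  have hDleib : ∀ f g, D (f * g) = eval α f * D g + eval α g * D f := by
    intro f g
    have e1 := hLeib ⟨h * f, hmul f⟩ ⟨h * g, hmul g⟩
    have e2 := hLeib ⟨h, hB⟩ ⟨h * (f * g), hmul _⟩
    have e3 : (⟨h * f, hmul f⟩ * ⟨h * g, hmul g⟩ : B) = ⟨h, hB⟩ * ⟨h * (f * g), hmul _⟩ :=
      Subtype.ext (by simp only [MulMemClass.coe_mul]; ring)
    rw [e3, e2] at e1
    simp only [map_mul, h1] at e1
    simp only [hD, map_mul]
    linear_combination e1
  have hsum := pointDerivation_eq_sum_pderiv α D hDleib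
  refine Or.inl ⟨fun i => D (X i), fun h0 => hL ?_, ?_⟩
  · ext f
    rw [← hDL, hsum]
    simp only [_root_.funext_iff, Pi.zero_apply] at h0
    simp [h0]
  · rintro f ⟨hf, hLf⟩
    rw [← hsum, hDL ⟨f, hf⟩, hLf]

/-- If a nonzero linear map satisfies the Leibniz rule both for `(a, b)` and for `(c, d)`, then
`c` is one of `a`, `b`. -/
theorem eq_or_eq_of_twisted_leibniz {K B : Type*} [Field K] [CommRing B] [Algebra K B]
    (a b c d : B →ₐ[K] K) (L : B →ₗ[K] K) (hL : L ≠ 0)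
    (hab : ∀ f g, L (f * g) = a f * L g + b g * L f)
    (hcd : ∀ f g, L (f * g) = c f * L g + d g * L f) :
    (∀ f, c f = a f) ∨ (∀ f, c f = b f) := by
  by_cases hca : ∀ f, c f = a f
  · exact Or.inl hca
  push Not at hca
  obtain ⟨f, hf⟩ := hca
  obtain ⟨g, hg⟩ : ∃ g, L g ≠ 0 := by
    by_contra! h
    exact hL (LinearMap.ext h)
  have hk : ∀ f, (c f - a f) * L g = (b g - d g) * L f := fun f => by
    linear_combination hab f g - hcd f g
  have hk0 : (b g - d g) * L f ≠ 0 := hk f ▸ mul_ne_zero (sub_ne_zero.mpr hf) hg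
  refine Or.inr fun x => ?_
  have h1 := hk (f * x)
  rw [hab, map_mul, map_mul] at h1
  have : (c x - b x) * ((b g - d g) * L f) = 0 := by
    linear_combination h1 - a f * hk x - c x * hk f
  exact sub_eq_zero.mp ((mul_eq_zero.mp this).resolve_right hk0)

/-- A linear map vanishing on the kernel of `L` and satisfying a Leibniz rule is either zero or
forces one of the points of the rule to be identified with those of `L`. -/
theorem eq_zero_or_eq_or_eq_of_ker_le {K B : Type*} [Field K] [CommRing B] [Algebra K B]
    (a b c d : B →ₐ[K] K) (L E : B →ₗ[K] K)
    (hab : ∀ f g, L (f * g) = a f * L g + b g * L f)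
    (hcd : ∀ f g, E (f * g) = c f * E g + d g * E f) (hker : ∀ f, L f = 0 → E f = 0) :
    E = 0 ∨ (∀ f, c f = a f) ∨ (∀ f, c f = b f) := by
  by_cases hE : E = 0
  · exact Or.inl hE
  obtain ⟨k, hk⟩ : ∃ k : K, ∀ f, E f = k * L f := by
    obtain ⟨g, hg⟩ : ∃ g, L g ≠ 0 := by
      by_contra! h
      exact hE (LinearMap.ext fun f => hker f (h f))
    refine ⟨E g / L g, fun f => ?_⟩
    have := hker (f - (L f / L g) • g) (by simp [hg])
    rw [map_sub, map_smul, smul_eq_mul, sub_eq_zero] at this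
    rw [this]
    ring
  refine Or.inr (eq_or_eq_of_twisted_leibniz a b c d E hE (fun f g => ?_) hcd)
  rw [hk, hk, hk, hab]
  ring

/-- If `A` is the kernel of a nonzero `α,β`-subalgebra condition `L` on a
finite-codimension subalgebra `B ⊆ K[x]`, then `Sp(A) = {α, β} ∪ Sp(B)`. -/
theorem stmt_15 {K : Type*} [Field K] [IsAlgClosed K] [CharZero K] {n : ℕ}
    (B : Subalgebra K (MvPolynomial (Fin n) K))
    [FiniteDimensional K (MvPolynomial (Fin n) K ⧸ Subalgebra.toSubmodule B)]
    (α β : Fin n → K) (L : B →ₗ[K] K) (hL : L ≠ 0)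
    (hLeib : ∀ f g : B, L (f * g) =
      eval α (f : MvPolynomial (Fin n) K) * L g + eval β (g : MvPolynomial (Fin n) K) * L f) :
    subalgSpectrum {f : MvPolynomial (Fin n) K | ∃ hf : f ∈ B, L ⟨f, hf⟩ = 0} =
      {α, β} ∪ subalgSpectrum (B : Set (MvPolynomial (Fin n) K)) := by
  refine Set.Subset.antisymm ?_ ?_
  · intro γ hγ
    by_contra hnot
    simp only [Set.mem_union, Set.mem_insert_iff, Set.mem_singleton_iff, not_or] at hnot
    obtain ⟨⟨hγα, hγβ⟩, hγB⟩ := hnot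
    let ev : (Fin n → K) → (B →ₐ[K] K) := fun δ => (aeval δ).comp B.val
    have hev : ∀ δ (f : B), ev δ f = eval δ (f : MvPolynomial (Fin n) K) := fun δ f => by
      simp [ev, aeval_eq_eval]
    have hLeib' : ∀ f g, L (f * g) = ev α f * L g + ev β g * L f := by
      simpa only [hev] using hLeib
    have hsep : ∀ δ, δ ≠ γ → ¬ ∀ f, ev γ f = ev δ f := fun δ hδ h =>
      hγB (Or.inr ⟨δ, hδ, fun f hf => by simpa only [hev] using h ⟨f, hf⟩⟩)
    have hno : ¬ ((∀ f, ev γ f = ev α f) ∨ (∀ f, ev γ f = ev β f)) := by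
      rintro (h | h)
      · exact hsep α (Ne.symm hγα) h
      · exact hsep β (Ne.symm hγβ) h
    rcases hγ with ⟨u, hu, hf⟩ | ⟨δ, hδ, hf⟩
    · let E : B →ₗ[K] K :=
        (∑ i, u i • ((aeval γ).toLinearMap ∘ₗ (pderiv i).toLinearMap)) ∘ₗ B.val.toLinearMap
      have hE : ∀ f : B, E f = ∑ i, u i * eval γ (pderiv i (f : MvPolynomial (Fin n) K)) :=
        fun f => by simp [E, aeval_eq_eval]
      rcases eq_zero_or_eq_or_eq_of_ker_le (ev α) (ev β) (ev γ) (ev γ) L E hLeib' (fun f g => by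
        simp only [hE, hev, Finset.mul_sum, ← Finset.sum_add_distrib, MulMemClass.coe_mul]
        refine Finset.sum_congr rfl fun i _ => ?_
        rw [Derivation.leibniz]
        simp only [smul_eq_mul, map_add, map_mul]
        ring) (fun f h => by rw [hE]; exact hf f ⟨f.2, h⟩) with h | h
      · exact hγB (Or.inl ⟨u, hu, fun f hfB => by
          rw [← hE ⟨f, hfB⟩, h, LinearMap.zero_apply]⟩)
      · exact hno h
    · let E : B →ₗ[K] K := (ev γ).toLinearMap - (ev δ).toLinearMap
      have hE : ∀ f, E f = ev γ f - ev δ f := fun f => rfl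
      rcases eq_zero_or_eq_or_eq_of_ker_le (ev α) (ev β) (ev γ) (ev δ) L E hLeib' (fun f g => by
        simp only [hE, map_mul]
        ring) (fun f h => by rw [hE, hev, hev, hf f ⟨f.2, h⟩, sub_self]) with h | h
      · exact hsep δ hδ fun f => sub_eq_zero.mp (by rw [← hE, h, LinearMap.zero_apply])
      · exact hno h
  · refine Set.union_subset ?_ (subalgSpectrum_anti fun f ⟨hf, _⟩ => hf)
    by_cases hαβ : α = β
    · subst hαβ
      rw [Set.pair_eq_singleton, Set.singleton_subset_iff]
      exact mem_subalgSpectrum_ker_of_pointDerivation B α L hL hLeib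
    · have key : ∀ f : MvPolynomial (Fin n) K, (∃ hf : f ∈ B, L ⟨f, hf⟩ = 0) →
          eval α f = eval β f := by
        rintro f ⟨hf, hLf⟩
        obtain ⟨g, hg⟩ : ∃ g, L g ≠ 0 := by
          by_contra! h
          exact hL (LinearMap.ext h)
        have h1 := hLeib ⟨f, hf⟩ g
        have h2 := hLeib g ⟨f, hf⟩
        rw [mul_comm, h2, hLf] at h1
        refine mul_right_cancel₀ hg ?_
        linear_combination -h1
      rintro γ (rfl | rfl)
      · exact Or.inr ⟨β, Ne.symm hαβ, key⟩
      · exact Or.inr ⟨α, hαβ, fun f hf => (key f hf).symm⟩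
end

section
/- Let A ⊆ K[x] be a subalgebra of finite codimension and let α, β ∈ Kⁿ be points that are not equivalent in A (i.e., there exists h ∈ A with h(α) ≠ h(β)). Let L : A → K be the character difference L(f) = f(α) − f(β) and set A' = A ∩ ker(L). If D₁ is an α-derivation on A and D₂ is a β-derivation on A such that D₁(f) = D₂(f) for all f ∈ A', then D₁(f) = D₂(f) = 0 for all f ∈ A'. -/
set_option synthInstance.maxHeartbeats 1000000
set_option maxHeartbeats 1000000

open MvPolynomial

/-- Let `α, β` be inequivalent points of a finite-codimension subalgebra
`A ⊆ K[x]` and `A' = A ∩ ker(f ↦ f(α) − f(β))`. If an `α`-derivation `D₁` and a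
`β`-derivation `D₂` on `A` agree on `A'`, then both vanish on `A'`. -/
theorem stmt_16 {K : Type*} [Field K] [IsAlgClosed K] [CharZero K] {n : ℕ}
    (A : Subalgebra K (MvPolynomial (Fin n) K))
    [FiniteDimensional K (MvPolynomial (Fin n) K ⧸ Subalgebra.toSubmodule A)]
    (α β : Fin n → K)
    (hsep : ∃ h : A, eval α (h : MvPolynomial (Fin n) K) ≠ eval β (h : MvPolynomial (Fin n) K))
    (D₁ D₂ : A →ₗ[K] K)
    (hD₁ : ∀ f g : A, D₁ (f * g) =
      eval α (f : MvPolynomial (Fin n) K) * D₁ g + D₁ f * eval α (g : MvPolynomial (Fin n) K))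
    (hD₂ : ∀ f g : A, D₂ (f * g) =
      eval β (f : MvPolynomial (Fin n) K) * D₂ g + D₂ f * eval β (g : MvPolynomial (Fin n) K))
    (hagree : ∀ f : A,
      eval α (f : MvPolynomial (Fin n) K) = eval β (f : MvPolynomial (Fin n) K) →
        D₁ f = D₂ f) :
    ∀ f : A,
      eval α (f : MvPolynomial (Fin n) K) = eval β (f : MvPolynomial (Fin n) K) →
        D₁ f = 0 ∧ D₂ f = 0 := by
  intro f hf
  obtain ⟨h, hh⟩ := hsep
  have D₁_one : D₁ 1 = 0 := by simpa using hD₁ 1 1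
  have D₂_one : D₂ 1 = 0 := by simpa using hD₂ 1 1
  set c := eval β (f : MvPolynomial (Fin n) K) with hc
  set d := eval β (h : MvPolynomial (Fin n) K) with hd
  have key := hagree ((f - c • 1) * (h - d • 1)) (by simp [smul_eval, hf, ← hc])
  rw [hD₁, hD₂] at key
  simp only [map_sub, map_smul, D₁_one, D₂_one, AddSubgroupClass.coe_sub, Subalgebra.coe_smul,
    Subalgebra.coe_one, smul_eval, map_one, hf, ← hc, ← hd, smul_zero, sub_zero, mul_one,
    sub_self, zero_mul, mul_zero, zero_add, add_zero] at key
  have hD₁f : D₁ f = 0 := (mul_eq_zero.mp key).resolve_right (sub_ne_zero.mpr hh)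
  exact ⟨hD₁f, hagree f hf ▸ hD₁f⟩
end

section
/- Let A ⊆ K[x] be a subalgebra of finite codimension and let α, β ∈ Kⁿ be points that are not equivalent in A (i.e., there exists h ∈ A with h(α) ≠ h(β)). Let L : A → K be the character difference L(f) = f(α) − f(β) and set A' = A ∩ ker(L). Then every α-derivation D on A' decomposes uniquely as a sum of restrictions: there exist a unique α-derivation D₁ on A and a unique β-derivation D₂ on A such that D(f) = D₁(f) + D₂(f) for all f ∈ A'. In other words, D_α(A') = D_α(A)|_{A'} ⊕ D_β(A)|_{A'}. -/
set_option synthInstance.maxHeartbeats 1000000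
set_option maxHeartbeats 1000000

open MvPolynomial

section CharacterDifference

variable {K P : Type*} [Field K] [CommRing P] [Algebra K P]

/-- The functional `f ↦ E ((f - a f) (3 e² - 2 e³))`. When `e` is `1` at the character `a` and `0`
at the character `b`, this extracts the `a`-part of a functional `E`. -/
noncomputable def characterPart (E : P →ₗ[K] K) (a : P →ₐ[K] K) (e : P) : P →ₗ[K] K :=
  E ∘ₗ LinearMap.mulRight K (e ^ 2 * (3 - 2 * e)) ∘ₗ
    (LinearMap.id - Algebra.linearMap K P ∘ₗ a.toLinearMap)

theorem characterPart_apply (E : P →ₗ[K] K) (a : P →ₐ[K] K) (e f : P) :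
    characterPart E a e f = E ((f - algebraMap K P (a f)) * (e ^ 2 * (3 - 2 * e))) := by
  rfl

theorem characterPart_mul {A : Subalgebra K P} {a b : P →ₐ[K] K} {E : P →ₗ[K] K}
    (hE : ∀ x ∈ A, ∀ y ∈ A, a x = 0 → b x = 0 → a y = 0 → b y = 0 → E (x * y) = 0)
    {e : P} (he : e ∈ A) (hb : b e = 0) {f g : P} (hf : f ∈ A) (hg : g ∈ A) :
    characterPart E a e (f * g) =
      a f * characterPart E a e g + characterPart E a e f * a g := by
  have h3 : (3 - 2 * e) ∈ A :=
    A.sub_mem (ofNat_mem A 3) (A.mul_mem (ofNat_mem A 2) he)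
  have hf' : f - algebraMap K P (a f) ∈ A := A.sub_mem hf (A.algebraMap_mem _)
  have hg' : g - algebraMap K P (a g) ∈ A := A.sub_mem hg (A.algebraMap_mem _)
  have key := hE ((f - algebraMap K P (a f)) * e) (A.mul_mem hf' he)
    ((g - algebraMap K P (a g)) * (e * (3 - 2 * e))) (A.mul_mem hg' (A.mul_mem he h3))
    (by simp) (by simp [hb]) (by simp) (by simp [hb])
  simp only [characterPart_apply]
  have hdecomp : (f * g - algebraMap K P (a (f * g))) * (e ^ 2 * (3 - 2 * e)) =
      (f - algebraMap K P (a f)) * e * ((g - algebraMap K P (a g)) * (e * (3 - 2 * e))) +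
      (a f • ((g - algebraMap K P (a g)) * (e ^ 2 * (3 - 2 * e))) +
       a g • ((f - algebraMap K P (a f)) * (e ^ 2 * (3 - 2 * e)))) := by
    simp only [Algebra.smul_def, map_mul]
    ring
  rw [hdecomp, map_add, key, map_add, map_smul, map_smul, smul_eq_mul, smul_eq_mul]
  ring

theorem characterPart_add_characterPart (E : P →ₗ[K] K) {a b : P →ₐ[K] K} (e : P)
    (hE : E 1 = 0) {f : P} (hf : a f = b f) :
    characterPart E a e f + characterPart E b (1 - e) f = E f := by
  simp only [characterPart_apply, ← map_add, ← hf]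
  have : (f - algebraMap K P (a f)) * (e ^ 2 * (3 - 2 * e)) +
      (f - algebraMap K P (a f)) * ((1 - e) ^ 2 * (3 - 2 * (1 - e))) = f - a f • 1 := by
    rw [Algebra.smul_def]
    ring
  rw [this, map_sub, map_smul, hE, smul_zero, sub_zero]

theorem eq_characterPart {A : Subalgebra K P} {a b : P →ₐ[K] K} {E D₁ D₂ : P →ₗ[K] K}
    (h₁ : ∀ f ∈ A, ∀ g ∈ A, D₁ (f * g) = a f * D₁ g + D₁ f * a g)
    (h₂ : ∀ f ∈ A, ∀ g ∈ A, D₂ (f * g) = b f * D₂ g + D₂ f * b g)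
    (hE : ∀ f ∈ A, a f = b f → E f = D₁ f + D₂ f)
    {e : P} (he : e ∈ A) (ha : a e = 1) (hb : b e = 0) {f : P} (hf : f ∈ A) :
    D₁ f = characterPart E a e f := by
  have h3 : (3 - 2 * e) ∈ A :=
    A.sub_mem (ofNat_mem A 3) (A.mul_mem (ofNat_mem A 2) he)
  have hf' : f - algebraMap K P (a f) ∈ A := A.sub_mem hf (A.algebraMap_mem _)
  have hu : e * (e * (3 - 2 * e)) ∈ A := A.mul_mem he (A.mul_mem he h3)
  have hone : D₁ 1 = 0 := by simpa using h₁ 1 A.one_mem 1 A.one_mem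
  have hsub : D₁ (f - algebraMap K P (a f)) = D₁ f := by
    rw [Algebra.algebraMap_eq_smul_one, map_sub, map_smul, hone, smul_zero, sub_zero]
  have hu₂ : D₂ (e * (e * (3 - 2 * e))) = 0 := by
    rw [h₂ e he _ (A.mul_mem he h3)]
    simp [hb]
  have hau : a (e * (e * (3 - 2 * e))) = 1 := by
    simp only [map_mul, map_sub, map_ofNat, ha]
    norm_num
  have hbu : b (e * (e * (3 - 2 * e))) = 0 := by simp [hb]
  rw [characterPart_apply, show e ^ 2 * (3 - 2 * e) = e * (e * (3 - 2 * e)) by ring,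
    hE _ (A.mul_mem hf' hu) (by rw [map_mul b, hbu]; simp), h₁ _ hf' _ hu, h₂ _ hf' _ hu,
    hsub, hu₂, hau, hbu]
  simp

end CharacterDifference

/-- Let `α, β` be inequivalent points of a finite-codimension subalgebra
`A ⊆ K[x]` and let `A'` be the subalgebra `A ∩ ker(f ↦ f(α) − f(β))`. Then every
`α`-derivation `D` on `A'` decomposes uniquely as the sum of the restrictions of an
`α`-derivation `D₁` on `A` and a `β`-derivation `D₂` on `A`:
`D_α(A') = D_α(A)|_{A'} ⊕ D_β(A)|_{A'}`. -/
theorem stmt_17 {K : Type*} [Field K] [IsAlgClosed K] [CharZero K] {n : ℕ}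
    (A A' : Subalgebra K (MvPolynomial (Fin n) K))
    [FiniteDimensional K (MvPolynomial (Fin n) K ⧸ Subalgebra.toSubmodule A)]
    (α β : Fin n → K)
    (hsep : ∃ h ∈ A, eval α h ≠ eval β h)
    (hA' : ∀ f : MvPolynomial (Fin n) K, f ∈ A' ↔ f ∈ A ∧ eval α f = eval β f)
    (D : A' →ₗ[K] K)
    (hD : ∀ f g : A', D (f * g) =
      eval α (f : MvPolynomial (Fin n) K) * D g + D f * eval α (g : MvPolynomial (Fin n) K)) :
    ∃! p : (A →ₗ[K] K) × (A →ₗ[K] K),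
      (∀ f g : A, p.1 (f * g) =
        eval α (f : MvPolynomial (Fin n) K) * p.1 g +
          p.1 f * eval α (g : MvPolynomial (Fin n) K)) ∧
      (∀ f g : A, p.2 (f * g) =
        eval β (f : MvPolynomial (Fin n) K) * p.2 g +
          p.2 f * eval β (g : MvPolynomial (Fin n) K)) ∧
      (∀ f : A', D f =
        p.1 ⟨(f : MvPolynomial (Fin n) K), ((hA' f).mp f.2).1⟩ +
          p.2 ⟨(f : MvPolynomial (Fin n) K), ((hA' f).mp f.2).1⟩) := by
  obtain ⟨h, hhA, hh⟩ := hsep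
  let a : MvPolynomial (Fin n) K →ₐ[K] K := aeval α
  let b : MvPolynomial (Fin n) K →ₐ[K] K := aeval β
  have ha (f) : a f = eval α f := by simp [a]
  have hb (f) : b f = eval β f := by simp [b]
  simp only [← ha, ← hb] at hh hA' hD ⊢
  obtain ⟨E, hED⟩ := LinearMap.exists_extend (p := Subalgebra.toSubmodule A') D
  have hE (f : A') : E f = D f := LinearMap.congr_fun hED f
  have hsub : a h - b h ≠ 0 := sub_ne_zero.mpr hh
  obtain ⟨e, he, hae, hbe⟩ : ∃ e ∈ A, a e = 1 ∧ b e = 0 :=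
    ⟨(a h - b h)⁻¹ • (h - algebraMap K _ (b h)),
      A.smul_mem (A.sub_mem hhA (A.algebraMap_mem _)) _, by
        rw [map_smul, map_sub, AlgHom.commutes]; simp [hsub], by
        rw [map_smul, map_sub, AlgHom.commutes]; simp⟩
  have he' : 1 - e ∈ A := A.sub_mem A.one_mem he
  have hae' : a (1 - e) = 0 := by rw [map_sub, map_one, hae, sub_self]
  have hbe' : b (1 - e) = 1 := by rw [map_sub, map_one, hbe, sub_zero]
  have hE1 : E 1 = 0 := by
    have h1 : D 1 = 0 := by simpa using hD 1 1
    exact (hE 1).trans h1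
  have hEmul : ∀ x ∈ A, ∀ y ∈ A, a x = 0 → b x = 0 → a y = 0 → b y = 0 → E (x * y) = 0 := by
    intro x hx y hy hax hbx hay hby
    have hx' : x ∈ A' := (hA' x).mpr ⟨hx, hax.trans hbx.symm⟩
    have hy' : y ∈ A' := (hA' y).mpr ⟨hy, hay.trans hby.symm⟩
    have hxy := hD ⟨x, hx'⟩ ⟨y, hy'⟩
    rw [hax, hay, zero_mul, mul_zero, add_zero] at hxy
    exact (hE _).trans hxy
  refine ⟨((characterPart E a e).domRestrict (Subalgebra.toSubmodule A),
    (characterPart E b (1 - e)).domRestrict (Subalgebra.toSubmodule A)), ⟨?_, ?_, ?_⟩, ?_⟩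
  · intro f g
    exact characterPart_mul hEmul he hbe f.2 g.2
  · intro f g
    exact characterPart_mul (fun x hx y hy hbx hax hby hay => hEmul x hx y hy hax hbx hay hby)
      he' hae' f.2 g.2
  · intro f
    exact ((characterPart_add_characterPart E e hE1 ((hA' f).mp f.2).2).trans (hE f)).symm
  · rintro ⟨p, q⟩ ⟨hp, hq, hpq⟩
    obtain ⟨F, hF⟩ := LinearMap.exists_extend (p := Subalgebra.toSubmodule A) p
    obtain ⟨G, hG⟩ := LinearMap.exists_extend (p := Subalgebra.toSubmodule A) q
    have hFp (f : A) : F f = p f := LinearMap.congr_fun hF f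
    have hGq (f : A) : G f = q f := LinearMap.congr_fun hG f
    have hFmul : ∀ f ∈ A, ∀ g ∈ A, F (f * g) = a f * F g + F f * a g := by
      intro f hf g hg
      have := hp ⟨f, hf⟩ ⟨g, hg⟩
      rwa [← hFp, ← hFp, ← hFp] at this
    have hGmul : ∀ f ∈ A, ∀ g ∈ A, G (f * g) = b f * G g + G f * b g := by
      intro f hf g hg
      have := hq ⟨f, hf⟩ ⟨g, hg⟩
      rwa [← hGq, ← hGq, ← hGq] at this
    have hsum : ∀ f ∈ A, a f = b f → E f = F f + G f := by
      intro f hf hab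
      have := hpq ⟨f, (hA' f).mpr ⟨hf, hab⟩⟩
      rwa [← hE, ← hFp, ← hGq] at this
    refine Prod.ext (LinearMap.ext fun f => ?_) (LinearMap.ext fun f => ?_)
    · exact (hFp f).symm.trans (eq_characterPart hFmul hGmul hsum he hae hbe f.2)
    · exact (hGq f).symm.trans (eq_characterPart hGmul hFmul
        (fun f hf hba => (hsum f hf hba.symm).trans (add_comm _ _)) he' hbe' hae' f.2)
end

section
/- (Main Theorem of α-Derivations) Let A ⊆ K[x] be a subalgebra of finite codimension and let α ∈ Kⁿ. Then there exists a natural number N such that every α-derivation D on A can be written as a finite linear combination of iterated partial derivative evaluations at points equivalent to α: there exist finitely many points α₁, …, α_k ∈ Kⁿ, each equivalent to α in A, and scalars c_{i,d} ∈ K indexed by i ∈ {1,…,k} and multi-indices d ∈ ℕⁿ with 1 ≤ |d| ≤ N − 1, such that D(f) = Σ_{i=1}^k Σ_{1 ≤ |d| ≤ N−1} c_{i,d}·(∂^d f)(α_i) for all f ∈ A, where ∂^d f denotes the iterated formal partial derivative (∂/∂x₁)^{d₁} ⋯ (∂/∂xₙ)^{dₙ} f and |d| = d₁ + ⋯ +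 dₙ. -/
set_option synthInstance.maxHeartbeats 1000000
set_option maxHeartbeats 1000000

open MvPolynomial

/-- The iterated formal partial derivative `∂^d = (∂/∂x₁)^{d₁} ⋯ (∂/∂xₙ)^{dₙ}` on `K[x]`,
for a multi-index `d : Fin n → ℕ`. -/
noncomputable def iterPDeriv {K : Type*} [CommRing K] {n : ℕ} (d : Fin n → ℕ) :
    Module.End K (MvPolynomial (Fin n) K) :=
  (List.ofFn (fun i : Fin n => (pderiv (R := K) i).toLinearMap ^ d i)).prod

theorem exists_coeff_list_prod_pderiv_pow {K : Type*} [Field K] [CharZero K] {n : ℕ}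
    (d : Fin n → ℕ) (l : List (Fin n)) (e : Fin n →₀ ℕ) :
    ∃ c : K, c ≠ 0 ∧ ∀ f : MvPolynomial (Fin n) K,
      coeff e ((l.map fun i => (pderiv (R := K) i).toLinearMap ^ d i).prod f) =
        c * coeff (e + (l.map fun i => Finsupp.single i (d i)).sum) f := by
  have key : ∀ (i : Fin n) (k : ℕ) (e : Fin n →₀ ℕ),
      ∃ c : K, c ≠ 0 ∧ ∀ f : MvPolynomial (Fin n) K,
        coeff e (((pderiv (R := K) i).toLinearMap ^ k) f) =
          c * coeff (e + Finsupp.single i k) f := by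
    intro i k
    induction k with
    | zero => exact fun e => ⟨1, one_ne_zero, fun f => by simp⟩
    | succ k ih =>
      intro e
      obtain ⟨c, hc, h⟩ := ih (e + Finsupp.single i 1)
      refine ⟨c * (e i + 1), mul_ne_zero hc (Nat.cast_add_one_ne_zero _), fun f => ?_⟩
      rw [pow_succ', Module.End.mul_apply]
      change coeff e (pderiv i _) = _
      rw [coeff_pderiv, h, add_assoc, ← Finsupp.single_add, add_comm 1 k]
      ring
  induction l generalizing e with
  | nil => exact ⟨1, one_ne_zero, fun f => by simp⟩
  | cons i l ih =>
    obtain ⟨c, hc, h⟩ := key i (d i) e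
    obtain ⟨c', hc', h'⟩ := ih (e + Finsupp.single i (d i))
    refine ⟨c * c', mul_ne_zero hc hc', fun f => ?_⟩
    rw [List.map_cons, List.prod_cons, Module.End.mul_apply, h, h', List.map_cons,
      List.sum_cons, add_assoc, mul_assoc]

theorem exists_coeff_iterPDeriv {K : Type*} [Field K] [CharZero K] {n : ℕ}
    (d e : Fin n →₀ ℕ) :
    ∃ c : K, c ≠ 0 ∧ ∀ f : MvPolynomial (Fin n) K,
      coeff e (iterPDeriv (K := K) d f) = c * coeff (e + d) f := by
  obtain ⟨c, hc, h⟩ := exists_coeff_list_prod_pderiv_pow (K := K) d (List.finRange n) e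
  refine ⟨c, hc, fun f => ?_⟩
  have hd : ((List.finRange n).map fun i => Finsupp.single i (d i)).sum = d := by
    rw [← List.ofFn_eq_map, List.sum_ofFn]
    exact Finsupp.univ_sum_single d
  rw [iterPDeriv, List.ofFn_eq_map, h, hd]

theorem iterPDeriv_one {K : Type*} [Field K] [CharZero K] {n : ℕ} {d : Fin n → ℕ} (hd : d ≠ 0) :
    iterPDeriv d (1 : MvPolynomial (Fin n) K) = 0 := by
  ext e
  obtain ⟨c, -, h⟩ := exists_coeff_iterPDeriv (K := K) (Finsupp.equivFunOnFinite.symm d) e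
  have h1 : (0 : Fin n →₀ ℕ) ≠ e + Finsupp.equivFunOnFinite.symm d := by
    intro h0
    apply hd
    ext i
    have : 0 = e i + d i := DFunLike.congr_fun h0 i
    exact (Nat.add_eq_zero_iff.1 this.symm).2
  have := h 1
  rw [coeff_one, if_neg h1, mul_zero] at this
  simpa using this

theorem iterPDeriv_zero {K : Type*} [CommRing K] {n : ℕ} :
    iterPDeriv (0 : Fin n → ℕ) = (1 : Module.End K (MvPolynomial (Fin n) K)) := by
  simp [iterPDeriv, List.ofFn_const]

/-- The algebra endomorphism of `K[x]` translating the variables by `β`. -/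
noncomputable def translateVars {K : Type*} [CommRing K] {n : ℕ} (β : Fin n → K) :
    MvPolynomial (Fin n) K →ₐ[K] MvPolynomial (Fin n) K :=
  aeval fun i => X i + C (β i)

theorem translate_neg_translate {K : Type*} [CommRing K] {n : ℕ} (β : Fin n → K)
    (f : MvPolynomial (Fin n) K) : translateVars (-β) (translateVars β f) = f := by
  have : (translateVars (-β)).comp (translateVars β) = AlgHom.id K _ := by
    ext i : 1
    simp [translateVars, algebraMap_eq]
  exact DFunLike.congr_fun this f

theorem constantCoeff_translate {K : Type*} [CommRing K] {n : ℕ} (β : Fin n → K)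
    (f : MvPolynomial (Fin n) K) : constantCoeff (translateVars β f) = eval β f := by
  have : (constantCoeff (R := K)).comp (translateVars β : _ →+* MvPolynomial (Fin n) K) = eval β := by
    ext i <;> simp [translateVars]
  exact DFunLike.congr_fun this f

theorem pderiv_translate {K : Type*} [CommRing K] {n : ℕ} (β : Fin n → K) (i : Fin n)
    (f : MvPolynomial (Fin n) K) : pderiv i (translateVars β f) = translateVars β (pderiv i f) := by
  classical
  induction f using MvPolynomial.induction_on with
  | C a => simp [translateVars]
  | add p q hp hq => simp [hp, hq]
  | mul_X p j hp =>
    simp only [map_mul, pderiv_mul, hp, map_add, pderiv_X]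
    by_cases h : j = i
    · subst h
      simp [translateVars, pderiv_X]
    · simp [translateVars, pderiv_X, h]

theorem iterPDeriv_translate {K : Type*} [CommRing K] {n : ℕ} (β : Fin n → K) (d : Fin n → ℕ)
    (f : MvPolynomial (Fin n) K) :
    iterPDeriv d (translateVars β f) = translateVars β (iterPDeriv d f) := by
  have key : Commute (iterPDeriv d) (translateVars β).toLinearMap := by
    refine Commute.list_prod_left _ _ fun x hx => ?_
    obtain ⟨i, rfl⟩ := (List.mem_ofFn' _ _).1 hx
    exact Commute.pow_left (LinearMap.ext fun f => pderiv_translate β i f) _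
  exact LinearMap.congr_fun key f

theorem mem_vanishingIdeal_pow_of_iterPDeriv {K : Type*} [Field K] [CharZero K] {n : ℕ}
    (β : Fin n → K) (N : ℕ) (f : MvPolynomial (Fin n) K)
    (h : ∀ d : Fin n → ℕ, ∑ j, d j < N → eval β (iterPDeriv d f) = 0) :
    f ∈ vanishingIdeal K {β} ^ N := by
  have h1 : translateVars β f ∈ idealOfVars (Fin n) K ^ N := by
    rw [mem_pow_idealOfVars_iff']
    intro d hd
    rw [Finsupp.degree_eq_sum] at hd
    obtain ⟨c, hc, hcf⟩ := exists_coeff_iterPDeriv (K := K) d 0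
    have := hcf (translateVars β f)
    rw [iterPDeriv_translate, ← constantCoeff_eq, constantCoeff_translate, h d hd, zero_add] at this
    exact (mul_eq_zero.1 this.symm).resolve_left hc
  have h2 := Ideal.mem_map_of_mem (translateVars (-β)) h1
  rw [translate_neg_translate, Ideal.map_pow] at h2
  refine Ideal.pow_right_mono ?_ N h2
  rw [Ideal.map_span, Ideal.span_le]
  rintro _ ⟨_, ⟨i, rfl⟩, rfl⟩
  simp [translateVars]

theorem exists_vanishingIdeal_pow_le {K : Type*} [Field K] [IsAlgClosed K] {n : ℕ}
    (L : Ideal (MvPolynomial (Fin n) K)) [FiniteDimensional K (MvPolynomial (Fin n) K ⧸ L)] :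
    ∃ (S : Finset (Fin n → K)) (N : ℕ), ∀ f : MvPolynomial (Fin n) K,
      (∀ β ∈ S, f ∈ vanishingIdeal K {β} ^ N) → f ∈ L := by
  classical
  have : IsArtinianRing (MvPolynomial (Fin n) K ⧸ L) := isArtinian_of_tower K inferInstance
  have hx : ∀ I : MaximalSpectrum (MvPolynomial (Fin n) K ⧸ L), ∃ x : Fin n → K,
      I.asIdeal.comap (Ideal.Quotient.mk L) = vanishingIdeal K {x} := fun I =>
    eq_vanishingIdeal_singleton_of_isMaximal K
      (Ideal.comap_isMaximal_of_surjective _ Ideal.Quotient.mk_surjective (H := I.isMaximal))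
  choose x hx using hx
  have := Fintype.ofFinite (MaximalSpectrum (MvPolynomial (Fin n) K ⧸ L))
  obtain ⟨N, hN⟩ := IsArtinianRing.isNilpotent_nilradical (R := MvPolynomial (Fin n) K ⧸ L)
  refine ⟨Finset.univ.image x, N, fun f hf => ?_⟩
  rw [← Ideal.Quotient.eq_zero_iff_mem, ← Ideal.mem_bot, ← Ideal.zero_eq_bot, ← hN,
    IsArtinianRing.nilradical_pow_eq_iInf, Ideal.mem_iInf]
  intro I
  have h1 := hf (x I) (Finset.mem_image_of_mem x (Finset.mem_univ I))
  rw [← hx I] at h1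
  have h2 := Ideal.mem_map_of_mem (Ideal.Quotient.mk L) h1
  rw [Ideal.map_pow] at h2
  exact Ideal.pow_right_mono Ideal.map_comap_le N h2

theorem exists_ideal_finite_quotient_le {K R : Type*} [Field K] [CommRing R] [Algebra K R]
    (A : Subalgebra K R) [FiniteDimensional K (R ⧸ Subalgebra.toSubmodule A)] :
    ∃ L : Ideal R, FiniteDimensional K (R ⧸ L) ∧ ∀ f ∈ L, f ∈ A := by
  let π := (Subalgebra.toSubmodule A).mkQ
  have hπ : ∀ f, π f = 0 ↔ f ∈ A := fun f => by simp [π]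
  obtain ⟨σ, hσ⟩ := π.exists_rightInverse_of_surjective (Submodule.range_mkQ _)
  replace hσ : ∀ q, π (σ q) = q := fun q => LinearMap.congr_fun hσ q
  let T : R →ₗ[K] (R ⧸ Subalgebra.toSubmodule A) ×
      ((R ⧸ Subalgebra.toSubmodule A) →ₗ[K] (R ⧸ Subalgebra.toSubmodule A)) :=
    π.prod (((LinearMap.lcomp K _ σ).comp (LinearMap.llcomp K R R _ π)).comp (LinearMap.mul K R))
  have hT : ∀ f, T f = 0 ↔ f ∈ A ∧ ∀ q, f * σ q ∈ A := fun f => by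
    simp [T, ← hπ, Prod.ext_iff, LinearMap.ext_iff]
  have hT' : ∀ f, T f = 0 → ∀ g, f * g ∈ A := by
    intro f hf g
    obtain ⟨h1, h2⟩ := (hT f).1 hf
    have hg : g - σ (π g) ∈ A := by rw [← hπ, map_sub, hσ, sub_self]
    have : f * g = f * (g - σ (π g)) + f * σ (π g) := by ring
    rw [this]
    exact A.add_mem (A.mul_mem h1 hg) (h2 _)
  let L : Ideal R :=
    { carrier := {f | T f = 0}
      add_mem' := fun {a b} ha hb => by
        simp only [Set.mem_ofPred_eq] at ha hb ⊢
        rw [map_add, ha, hb, add_zero]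
      zero_mem' := map_zero T
      smul_mem' := fun c f hf => by
        refine (hT _).2 ⟨?_, fun q => ?_⟩
        · rw [smul_eq_mul, mul_comm]
          exact hT' f hf c
        · rw [smul_eq_mul, mul_comm c, mul_assoc]
          exact hT' f hf _ }
  refine ⟨L, ?_, fun f hf => ((hT f).1 hf).1⟩
  have hL : L.restrictScalars K = LinearMap.ker T := by
    ext f
    exact Iff.rfl
  let T' : (R ⧸ L) →ₗ[K] _ := (L.restrictScalars K).liftQ T hL.le
  refine FiniteDimensional.of_injective T' (LinearMap.ker_eq_bot.1 ?_)
  exact Submodule.ker_liftQ_eq_bot' _ _ hL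

theorem exists_mem_vanishingIdeal_pow_eval_eq_one {K : Type*} [Field K] {n : ℕ}
    (A : Subalgebra K (MvPolynomial (Fin n) K)) (α : Fin n → K) (S : Finset (Fin n → K))
    (N : ℕ) (hS : ∀ β ∈ S, ∃ f ∈ A, eval β f ≠ eval α f) :
    ∃ u ∈ A, eval α u = 1 ∧ ∀ β ∈ S, u ∈ vanishingIdeal K {β} ^ N := by
  classical
  induction S using Finset.induction with
  | empty => exact ⟨1, A.one_mem, map_one _, by simp⟩
  | insert β S _ ih =>
    obtain ⟨u, huA, huα, hu⟩ := ih fun γ hγ => hS γ (Finset.mem_insert_of_mem hγ)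
    obtain ⟨f, hfA, hf⟩ := hS β (Finset.mem_insert_self _ _)
    let g := C (eval α f - eval β f)⁻¹ * (f - C (eval β f))
    have hgA : g ∈ A :=
      A.mul_mem (A.algebraMap_mem _) (A.sub_mem hfA (A.algebraMap_mem _))
    have hgα : eval α g = 1 := by
      simpa [g] using inv_mul_cancel₀ (sub_ne_zero.2 hf.symm)
    have hgβ : g ∈ vanishingIdeal K {β} := by
      simp [g, aeval_eq_eval]
    refine ⟨u * g ^ N, A.mul_mem huA (A.pow_mem hgA N), by simp [huα, hgα], fun γ hγ => ?_⟩
    rcases Finset.mem_insert.1 hγ with rfl | hγ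
    · exact Ideal.mul_mem_left _ _ (Ideal.pow_mem_pow hgβ N)
    · exact Ideal.mul_mem_right _ _ (hu γ hγ)

theorem mem_mul_self_of_forall_mem_vanishingIdeal_pow {K : Type*} [Field K] {n : ℕ}
    (S : Finset (Fin n → K)) (N : ℕ) (f : MvPolynomial (Fin n) K)
    (hf : ∀ β ∈ S, f ∈ vanishingIdeal K {β} ^ (2 * N)) :
    f ∈ (⨅ β ∈ S, vanishingIdeal K {β} ^ N) * ⨅ β ∈ S, vanishingIdeal K {β} ^ N := by
  have hco : ∀ m : ℕ, ((S : Set (Fin n → K))).Pairwise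
      (Function.onFun IsCoprime fun β => vanishingIdeal K {β} ^ m) := by
    intro m β _ γ _ hne
    refine IsCoprime.pow (Ideal.isCoprime_of_isMaximal fun h => hne ?_)
    ext i
    have : (X i - C (γ i) : MvPolynomial (Fin n) K) ∈ vanishingIdeal K {β} := by
      rw [h]
      simp
    simpa [mem_vanishingIdeal_singleton_iff, sub_eq_zero] using this
  rw [← Ideal.prod_eq_iInf_of_pairwise_isCoprime (hco N), ← Finset.prod_mul_distrib]
  simp_rw [← pow_add, ← two_mul]
  rw [Ideal.prod_eq_iInf_of_pairwise_isCoprime (hco (2 * N))]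
  simpa [Submodule.mem_iInf] using hf

/-- A functional killing the polynomials that vanish to order `N` at every point of `S` is a
combination of partial derivatives of order less than `N` at the points of `S`. -/
theorem exists_sum_iterPDeriv_of_forall_vanishingIdeal_pow {K : Type*} [Field K] [CharZero K]
    {n : ℕ} (S : Finset (Fin n → K)) (N : ℕ) (φ : MvPolynomial (Fin n) K →ₗ[K] K)
    (hφ : ∀ f, (∀ β ∈ S, f ∈ vanishingIdeal K {β} ^ N) → φ f = 0)
    (Ds : Finset (Fin n → ℕ)) (hDs : ∀ d, ∑ j, d j < N → d ∈ Ds) :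
    ∃ c : S → (Fin n → ℕ) → K, ∀ f,
      φ f = ∑ β : S, ∑ d ∈ Ds, c β d * eval (β : Fin n → K) (iterPDeriv d f) := by
  classical
  let ev : S × Ds → MvPolynomial (Fin n) K →ₗ[K] K := fun p =>
    (aeval (R := K) (p.1 : Fin n → K)).toLinearMap.comp (iterPDeriv (p.2 : Fin n → ℕ))
  have hev : ∀ p f, ev p f = eval (p.1 : Fin n → K) (iterPDeriv (p.2 : Fin n → ℕ) f) :=
    fun p f => by simp [ev, aeval_eq_eval]
  have hmem : φ ∈ Submodule.span K (Set.range ev) := by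
    refine mem_span_of_iInf_ker_le_ker fun f hf => hφ f fun β hβ => ?_
    simp only [Submodule.mem_iInf, LinearMap.mem_ker] at hf
    refine mem_vanishingIdeal_pow_of_iterPDeriv β N f fun d hd => ?_
    rw [← hev (⟨β, hβ⟩, ⟨d, hDs d hd⟩)]
    exact hf _
  obtain ⟨c, hc⟩ := (Submodule.mem_span_range_iff_exists_fun K).1 hmem
  refine ⟨fun β d => if h : d ∈ Ds then c (β, ⟨d, h⟩) else 0, fun f => ?_⟩
  rw [← hc, LinearMap.sum_apply, Fintype.sum_prod_type]
  refine Finset.sum_congr rfl fun β _ => ?_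
  rw [← Finset.sum_coe_sort Ds]
  refine Finset.sum_congr rfl fun d _ => ?_
  simp [hev]

/-- **Main Theorem of `α`-Derivations.** For any finite-codimension
subalgebra `A ⊆ K[x]` and point `α`, there is an `N` such that every `α`-derivation on `A`
is a finite linear combination of iterated partial-derivative evaluations, of orders
between `1` and `N − 1`, at points equivalent to `α` in `A`. -/
theorem stmt_18 {K : Type*} [Field K] [IsAlgClosed K] [CharZero K] {n : ℕ}
    (A : Subalgebra K (MvPolynomial (Fin n) K))
    [FiniteDimensional K (MvPolynomial (Fin n) K ⧸ Subalgebra.toSubmodule A)]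
    (α : Fin n → K) :
    ∃ N : ℕ, ∀ D : A →ₗ[K] K,
      (∀ f g : A, D (f * g) =
        eval α (f : MvPolynomial (Fin n) K) * D g +
          D f * eval α (g : MvPolynomial (Fin n) K)) →
      ∃ (k : ℕ) (pts : Fin k → (Fin n → K)) (Ds : Finset (Fin n → ℕ))
        (c : Fin k → (Fin n → ℕ) → K),
        (∀ i : Fin k, ∀ f ∈ A, eval (pts i) f = eval α f) ∧
        (∀ d ∈ Ds, 1 ≤ ∑ j : Fin n, d j ∧ ∑ j : Fin n, d j ≤ N - 1) ∧
        (∀ f : A, D f =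
          ∑ i : Fin k, ∑ d ∈ Ds,
            c i d * eval (pts i) (iterPDeriv d (f : MvPolynomial (Fin n) K))) := by
  classical
  obtain ⟨L, _, hLA⟩ := exists_ideal_finite_quotient_le A
  obtain ⟨S₀, N₀, hL⟩ := exists_vanishingIdeal_pow_le L
  let S := insert α S₀
  let N := N₀ + 1
  let Q : Ideal (MvPolynomial (Fin n) K) := ⨅ β ∈ S, vanishingIdeal K {β} ^ N
  have hQ : ∀ f ∈ Q, f ∈ A ∧ eval α f = 0 := by
    intro f hf
    simp only [Q, Submodule.mem_iInf] at hf
    refine ⟨hLA f (hL f fun β hβ =>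
      Ideal.pow_le_pow_right (Nat.le_succ _) (hf β (Finset.mem_insert_of_mem hβ))), ?_⟩
    have := Ideal.pow_le_self (Nat.succ_ne_zero _) (hf α (Finset.mem_insert_self _ _))
    simpa [mem_vanishingIdeal_singleton_iff, aeval_eq_eval] using this
  refine ⟨2 * N, fun D hD => ?_⟩
  obtain ⟨E, hE⟩ := LinearMap.exists_extend (p := Subalgebra.toSubmodule A) D
  replace hE : ∀ f : A, E f = D f := fun f => LinearMap.congr_fun hE f
  have hEQ : ∀ f ∈ Q * Q, E f = 0 := by
    intro f hf
    refine Submodule.mul_induction_on hf (fun g hg h hh => ?_)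
      (fun g h hg hh => by rw [map_add, hg, hh, add_zero])
    obtain ⟨hgA, hgα⟩ := hQ g hg
    obtain ⟨hhA, hhα⟩ := hQ h hh
    have := hD ⟨g, hgA⟩ ⟨h, hhA⟩
    rw [← hE] at this
    simpa [hgα, hhα] using this
  let T := S.filter fun β => ∀ f ∈ A, eval β f = eval α f
  have hαT : α ∈ T := Finset.mem_filter.2 ⟨Finset.mem_insert_self _ _, fun _ _ => rfl⟩
  obtain ⟨u, huA, huα, hu⟩ := exists_mem_vanishingIdeal_pow_eval_eq_one A α (S \ T) (2 * N) (by
    intro β hβ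
    obtain ⟨h1, h2⟩ := Finset.mem_sdiff.1 hβ
    by_contra! h
    exact h2 (Finset.mem_filter.2 ⟨h1, h⟩))
  let φ : MvPolynomial (Fin n) K →ₗ[K] K :=
    E.comp (LinearMap.mulLeft K u) - E u • (aeval (R := K) α).toLinearMap
  have hφ : ∀ f, φ f = E (u * f) - E u * eval α f := fun f => by simp [φ, aeval_eq_eval]
  have hφD : ∀ f : A, D f = φ f := by
    intro f
    have := hD ⟨u, huA⟩ f
    rw [← hE, ← hE ⟨u, huA⟩] at this
    simp only [MulMemClass.coe_mul, huα] at this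
    rw [hφ, this]
    ring
  have hφ0 : ∀ f, (∀ β ∈ T, f ∈ vanishingIdeal K {β} ^ (2 * N)) → φ f = 0 := by
    intro f hf
    have h1 : eval α f = 0 := by
      have := Ideal.pow_le_self (by simp [N]) (hf α hαT)
      simpa [mem_vanishingIdeal_singleton_iff, aeval_eq_eval] using this
    rw [hφ, h1, mul_zero, sub_zero]
    refine hEQ _ (mem_mul_self_of_forall_mem_vanishingIdeal_pow S N _ fun β hβ => ?_)
    by_cases hβT : β ∈ T
    · exact Ideal.mul_mem_left _ _ (hf β hβT)
    · exact Ideal.mul_mem_right _ _ (hu β (Finset.mem_sdiff.2 ⟨hβ, hβT⟩))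
  let Ds : Finset (Fin n → ℕ) :=
    (Fintype.piFinset fun _ => Finset.range (2 * N)).filter fun d => 1 ≤ ∑ j, d j ∧
      ∑ j, d j ≤ 2 * N - 1
  have h0Ds : (0 : Fin n → ℕ) ∉ Ds := by simp [Ds]
  obtain ⟨c, hc⟩ := exists_sum_iterPDeriv_of_forall_vanishingIdeal_pow T (2 * N) φ hφ0
    (insert 0 Ds) (by
      intro d hd
      rw [Finset.mem_insert]
      by_cases hd0 : d = 0
      · exact Or.inl hd0
      · refine Or.inr (Finset.mem_filter.2 ⟨?_, ?_, by omega⟩)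
        · rw [Fintype.mem_piFinset]
          intro j
          have := Finset.single_le_sum (f := d) (fun _ _ => Nat.zero_le _) (Finset.mem_univ j)
          exact Finset.mem_range.2 (by omega)
        · by_contra! h
          apply hd0
          ext j
          exact Finset.sum_eq_zero_iff.1 (Nat.lt_one_iff.1 h) j (Finset.mem_univ j))
  have hT : ∀ β : T, ∀ f ∈ A, eval (β : Fin n → K) f = eval α f := fun β =>
    (Finset.mem_filter.1 β.2).2
  have hDf : ∀ f : A, D f = (∑ β : T, c β 0) * eval α (f : MvPolynomial (Fin n) K) +
      ∑ β : T, ∑ d ∈ Ds, c β d * eval (β : Fin n → K) (iterPDeriv d (f : MvPolynomial _ K)) := by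
    intro f
    rw [hφD, hc, Finset.sum_mul, ← Finset.sum_add_distrib]
    refine Finset.sum_congr rfl fun β _ => ?_
    rw [Finset.sum_insert h0Ds, iterPDeriv_zero, Module.End.one_apply, hT β f f.2]
  have hsum : ∑ β : T, c β 0 = 0 := by
    have h1 := hDf 1
    have hD1 : D 1 = 0 := by simpa using hD 1 1
    have h2 : ∑ β : T, ∑ d ∈ Ds, c β d * eval (β : Fin n → K)
        (iterPDeriv d ((1 : A) : MvPolynomial _ K)) = 0 := by
      refine Finset.sum_eq_zero fun β _ => Finset.sum_eq_zero fun d hd => ?_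
      rw [OneMemClass.coe_one, iterPDeriv_one (ne_of_mem_of_not_mem hd h0Ds), map_zero, mul_zero]
    rw [hD1, h2, OneMemClass.coe_one, map_one, mul_one, add_zero] at h1
    exact h1.symm
  refine ⟨T.card, fun i => T.equivFin.symm i, Ds, fun i => c (T.equivFin.symm i),
    fun i => hT _, fun d hd => (Finset.mem_filter.1 hd).2, fun f => ?_⟩
  rw [hDf, hsum, zero_mul, zero_add]
  exact (Equiv.sum_comp T.equivFin.symm fun β : T => ∑ d ∈ Ds,
    c β d * eval (β : Fin n → K) (iterPDeriv d (f : MvPolynomial _ K))).symm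
end

section
/- Let A ⊆ K[x] be a subalgebra of finite codimension whose subalgebra spectrum Sp(A) is a finite set forming a single cluster, i.e., any two points of Sp(A) are equivalent in A. Then there exists a natural number N ≥ 1 such that for every f ∈ K[x] and every family (π_α)_{α ∈ Sp(A)} of polynomials, where each π_α is a product of exactly N (not necessarily distinct) linear factors of the form (x_i − α_i) with i ∈ {1,…,n} and α = (α₁,…,αₙ), the product f · ∏_{α ∈ Sp(A)} π_α belongs to A. -/
set_option synthInstance.maxHeartbeats 1000000
set_option maxHeartbeats 1000000

open MvPolynomial

/-- First-order Taylor expansion at `α`, modulo the square of the ideal `(x₁ - α₁, …, xₙ - αₙ)`. -/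
theorem taylor_sub_mem_sq {K : Type*} [Field K] {n : ℕ} (α : Fin n → K)
    (g : MvPolynomial (Fin n) K) :
    g - C (eval α g) - ∑ i, C (eval α (pderiv i g)) * (X i - C (α i)) ∈
      (Ideal.span (Set.range fun i : Fin n => (X i - C (α i) : MvPolynomial (Fin n) K))) ^ 2 := by
  set m := Ideal.span (Set.range fun i : Fin n => (X i - C (α i) : MvPolynomial (Fin n) K))
  have hX : ∀ i, (X i - C (α i) : MvPolynomial (Fin n) K) ∈ m := fun i =>
    Ideal.subset_span ⟨i, rfl⟩
  induction g using MvPolynomial.induction_on with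
  | C a => simp
  | add p q hp hq =>
    convert add_mem hp hq using 1
    simp only [map_add, add_mul, Finset.sum_add_distrib]
    ring
  | mul_X p j hp =>
    have hlin : ∑ i, C (eval α (pderiv i p)) * (X i - C (α i)) ∈ m :=
      sum_mem fun i _ => Ideal.mul_mem_left _ _ (hX i)
    have h2 := add_mem (Ideal.mul_mem_right (X j) _ hp)
      (show (∑ i, C (eval α (pderiv i p)) * (X i - C (α i))) * (X j - C (α j)) ∈ m ^ 2 by
        rw [pow_two]; exact Ideal.mul_mem_mul hlin (hX j))
    convert h2 using 1
    have hsum : ∑ i, C (eval α (pderiv i (p * X j))) * (X i - C (α i)) =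
        C (α j) * ∑ i, C (eval α (pderiv i p)) * (X i - C (α i)) +
          C (eval α p) * (X j - C (α j)) := by
      have : ∀ i, C (eval α (pderiv i (p * X j))) * (X i - C (α i)) =
          C (α j) * (C (eval α (pderiv i p)) * (X i - C (α i))) +
            if i = j then C (eval α p) * (X j - C (α j)) else 0 := by
        intro i
        rw [pderiv_mul, pderiv_X]
        by_cases h : i = j
        · subst h
          simp
          ring
        · simp [h]
          ring
      simp only [this, Finset.sum_add_distrib, Finset.mul_sum, Finset.sum_ite_eq',
        Finset.mem_univ, if_true]
    rw [hsum]
    simp only [map_mul, eval_X]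
    ring

theorem sub_C_eval_mem_span {K : Type*} [Field K] {n : ℕ} (α : Fin n → K)
    (g : MvPolynomial (Fin n) K) :
    g - C (eval α g) ∈
      Ideal.span (Set.range fun i : Fin n => (X i - C (α i) : MvPolynomial (Fin n) K)) := by
  have h := Ideal.pow_le_self two_ne_zero (taylor_sub_mem_sq α g)
  rw [← sub_add_cancel (g - C (eval α g)) (∑ i, C (eval α (pderiv i g)) * (X i - C (α i)))]
  exact add_mem h (sum_mem fun i _ => Ideal.mul_mem_left _ _ (Ideal.subset_span ⟨i, rfl⟩))

/-- The elements of `A` vanishing at `α`. -/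
noncomputable def vanishingAt {K : Type*} [Field K] {n : ℕ} (A : Subalgebra K (MvPolynomial (Fin n) K))
    (α : Fin n → K) : Ideal A :=
  RingHom.ker ((eval α).comp (algebraMap A (MvPolynomial (Fin n) K)))

theorem sub_C_eval_mem_map_vanishingAt {K : Type*} [Field K] {n : ℕ}
    {A : Subalgebra K (MvPolynomial (Fin n) K)} (α : Fin n → K)
    {f : MvPolynomial (Fin n) K} (hf : f ∈ A) :
    f - C (eval α f) ∈ (vanishingAt A α).map (algebraMap A (MvPolynomial (Fin n) K)) := by
  have hA : f - C (eval α f) ∈ A := sub_mem hf (A.algebraMap_mem _)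
  refine Ideal.mem_map_of_mem (algebraMap A (MvPolynomial (Fin n) K))
    (x := (⟨_, hA⟩ : A)) ?_
  change eval α (f - C (eval α f)) = 0
  simp

/-- An ideal that is generated modulo its square by `J` and is contained in the radical of `J`
is contained in `J`. -/
theorem Ideal.le_of_le_sup_sq_of_le_radical {R : Type*} [CommRing R] {J m : Ideal R}
    (hfg : m.FG) (h : m ≤ J ⊔ m ^ 2) (hr : m ≤ J.radical) : m ≤ J := by
  obtain ⟨k, hk⟩ := Ideal.exists_pow_le_of_le_radical_of_fg hr hfg
  have key : ∀ j : ℕ, m ≤ J ⊔ m ^ (j + 1) := by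
    intro j
    induction j with
    | zero => simp
    | succ j ih =>
      refine h.trans (sup_le le_sup_left ?_)
      rw [pow_two]
      refine (Ideal.mul_mono_right ih).trans ?_
      rw [Ideal.mul_sup, ← pow_succ']
      exact sup_le_sup_right Ideal.mul_le_right _
  exact (key k).trans (sup_le le_rfl ((Ideal.pow_le_pow_right (Nat.le_succ k)).trans hk))

theorem span_le_map_vanishingAt {K : Type*} [Field K] [IsAlgClosed K] {n : ℕ}
    {A : Subalgebra K (MvPolynomial (Fin n) K)} {α : Fin n → K}
    (hα : α ∉ subalgSpectrum (A : Set (MvPolynomial (Fin n) K))) :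
    Ideal.span (Set.range fun i : Fin n => (X i - C (α i) : MvPolynomial (Fin n) K)) ≤
      (vanishingAt A α).map (algebraMap A (MvPolynomial (Fin n) K)) := by
  simp only [subalgSpectrum, Set.mem_ofPred_eq, not_or, not_exists, not_and] at hα
  obtain ⟨htan, hsep⟩ := hα
  refine Ideal.le_of_le_sup_sq_of_le_radical (Submodule.fg_span (Set.finite_range _)) ?_ ?_
  · let D : MvPolynomial (Fin n) K →ₗ[K] (Fin n → K) :=
      LinearMap.pi fun i => (aeval α).toLinearMap ∘ₗ (pderiv i).toLinearMap
    have hD : ∀ f i, D f i = eval α (pderiv i f) := fun f i => by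
      simp [D, MvPolynomial.aeval_eq_eval]
    have htop : (Subalgebra.toSubmodule A).map D = ⊤ := by
      by_contra hne
      obtain ⟨φ, hφ, hle⟩ := Submodule.exists_le_ker_of_lt_top _ (lt_top_iff_ne_top.2 hne)
      refine htan (fun i => φ (Pi.single i 1)) ?_ ?_
      · intro h0
        refine hφ (LinearMap.pi_ext' fun i => LinearMap.ext_ring ?_)
        simpa using congrFun h0 i
      · intro f hf
        have h0 : φ (D f) = 0 := hle (Submodule.mem_map_of_mem hf)
        rw [LinearMap.pi_apply_eq_sum_univ] at h0
        rw [← h0]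
        refine Finset.sum_congr rfl fun i _ => ?_
        rw [hD, smul_eq_mul, mul_comm]
        congr 2
        ext j
        simp [Pi.single_apply, eq_comm]
    rw [Ideal.span_le]
    rintro _ ⟨i, rfl⟩
    obtain ⟨f, hf, hfi⟩ : (Pi.single i 1 : Fin n → K) ∈ (Subalgebra.toSubmodule A).map D :=
      htop ▸ Submodule.mem_top
    have hsum : ∑ j, C (eval α (pderiv j f)) * (X j - C (α j)) =
        (X i - C (α i) : MvPolynomial (Fin n) K) := by
      simp only [← hD, hfi]
      rw [Finset.sum_eq_single i]
      · simp
      · intro j _ hj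
        simp [hj]
      · simp
    have ht := taylor_sub_mem_sq α f
    rw [hsum] at ht
    exact Submodule.mem_sup.2 ⟨_, sub_C_eval_mem_map_vanishingAt α hf, _, neg_mem ht, by ring⟩
  · rw [← MvPolynomial.vanishingIdeal_zeroLocus_eq_radical (k := K) (K := K), Ideal.span_le]
    rintro _ ⟨i, rfl⟩
    refine MvPolynomial.mem_vanishingIdeal_iff.2 fun β hβ => ?_
    have : β = α := by
      by_contra hne
      refine hsep β hne fun f hf => ?_
      have := MvPolynomial.mem_zeroLocus_iff.1 hβ _ (sub_C_eval_mem_map_vanishingAt α hf)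
      simp [MvPolynomial.aeval_eq_eval] at this
      exact (sub_eq_zero.1 this).symm
    simp [this]

/-- The largest ideal of the ambient ring contained in `A`. -/
def Subalgebra.conductorIdeal {K R : Type*} [CommRing K] [CommRing R] [Algebra K R]
    (A : Subalgebra K R) : Ideal R where
  carrier := {c | ∀ f, f * c ∈ A}
  add_mem' := fun ha hb f => by rw [mul_add]; exact add_mem (ha f) (hb f)
  zero_mem' := fun f => by rw [mul_zero]; exact zero_mem _
  smul_mem' := fun c x hx f => by rw [smul_eq_mul, ← mul_assoc]; exact hx _

theorem exists_mem_conductorIdeal_eval_ne_zero {K : Type*} [Field K] [IsAlgClosed K] {n : ℕ}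
    {A : Subalgebra K (MvPolynomial (Fin n) K)}
    [FiniteDimensional K (MvPolynomial (Fin n) K ⧸ Subalgebra.toSubmodule A)] {α : Fin n → K}
    (hα : α ∉ subalgSpectrum (A : Set (MvPolynomial (Fin n) K))) :
    ∃ c ∈ A.conductorIdeal, eval α c ≠ 0 := by
  let B : Submodule A (MvPolynomial (Fin n) K) := 1
  have hB : ∀ g, g ∈ B ↔ g ∈ A := fun g => by
    simp [B, Submodule.mem_one, Subtype.exists]
  have hBA : B.restrictScalars K = Subalgebra.toSubmodule A := by
    ext g
    simp [hB]
  have hfinK : Module.Finite K (MvPolynomial (Fin n) K ⧸ B) := by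
    have : Module.Finite K (MvPolynomial (Fin n) K ⧸ B.restrictScalars K) := by
      rw [hBA]; infer_instance
    exact Module.Finite.equiv (Submodule.Quotient.restrictScalarsEquiv K B)
  have hfinA : Module.Finite A (MvPolynomial (Fin n) K ⧸ B) :=
    Module.Finite.of_restrictScalars_finite K A _
  have hle : (⊤ : Submodule A (MvPolynomial (Fin n) K ⧸ B)) ≤ vanishingAt A α • ⊤ := by
    rintro x -
    obtain ⟨g, rfl⟩ := B.mkQ_surjective x
    have hg := span_le_map_vanishingAt hα (sub_C_eval_mem_span α g)
    have hg' : g - C (eval α g) ∈ vanishingAt A α • (⊤ : Submodule A (MvPolynomial (Fin n) K)) := by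
      rw [Ideal.smul_top_eq_map]
      exact hg
    have h := Submodule.mem_map_of_mem (f := B.mkQ) hg'
    rw [Submodule.map_smul'', Submodule.map_top, Submodule.range_mkQ, map_sub,
      show B.mkQ (C (eval α g)) = 0 from
        (Submodule.Quotient.mk_eq_zero B).2 ((hB _).2 (A.algebraMap_mem _)), sub_zero] at h
    exact h
  obtain ⟨r, hr, hr0⟩ :=
    Submodule.exists_sub_one_mem_and_smul_eq_zero_of_fg_of_le_smul _ _ hfinA.fg_top hle
  refine ⟨r, fun f => ?_, ?_⟩
  · have h := hr0 (B.mkQ f) trivial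
    rw [← map_smul, Submodule.mkQ_apply, Submodule.Quotient.mk_eq_zero, hB] at h
    rw [mul_comm]
    exact h
  · have h : eval α ((r : MvPolynomial (Fin n) K) - 1) = 0 := hr
    rw [map_sub, map_one, sub_eq_zero] at h
    rw [h]
    exact one_ne_zero

/-- Let `A ⊆ K[x]` have finite codimension, with finite subalgebra
spectrum forming a single cluster. Then there is `N ≥ 1` such that for every polynomial
`f` and every choice, for each spectral point `α`, of a product `π α` of exactly `N`
linear factors of the form `xᵢ − αᵢ`, the product `f · ∏_{α ∈ Sp(A)} π α` lies in `A`. -/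
theorem stmt_19 {K : Type*} [Field K] [IsAlgClosed K] [CharZero K] {n : ℕ}
    (A : Subalgebra K (MvPolynomial (Fin n) K))
    [FiniteDimensional K (MvPolynomial (Fin n) K ⧸ Subalgebra.toSubmodule A)]
    (hfin : (subalgSpectrum (A : Set (MvPolynomial (Fin n) K))).Finite)
    (hcluster : ∀ p ∈ subalgSpectrum (A : Set (MvPolynomial (Fin n) K)),
      ∀ q ∈ subalgSpectrum (A : Set (MvPolynomial (Fin n) K)),
        ∀ f ∈ A, eval p f = eval q f) :
    ∃ N : ℕ, 1 ≤ N ∧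
      ∀ (f : MvPolynomial (Fin n) K) (π : (Fin n → K) → MvPolynomial (Fin n) K),
        (∀ α ∈ subalgSpectrum (A : Set (MvPolynomial (Fin n) K)),
          ∃ l : Fin N → Fin n, π α = ∏ j : Fin N, (X (l j) - C (α (l j)))) →
        f * ∏ α ∈ hfin.toFinset, π α ∈ A := by
  obtain ⟨N, hN⟩ := Ideal.exists_radical_pow_le_of_fg A.conductorIdeal
    (IsNoetherian.noetherian _)
  refine ⟨N + 1, Nat.succ_pos N, fun f π hπ => ?_⟩
  have hmem : ∀ p : MvPolynomial (Fin n) K,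
      (∀ α ∈ subalgSpectrum (A : Set (MvPolynomial (Fin n) K)), eval α p = 0) →
        p ∈ A.conductorIdeal.radical := by
    intro p hp
    rw [← MvPolynomial.vanishingIdeal_zeroLocus_eq_radical (k := K) (K := K)]
    refine MvPolynomial.mem_vanishingIdeal_iff.2 fun β hβ => ?_
    rw [MvPolynomial.aeval_eq_eval]
    refine hp β ?_
    by_contra hns
    obtain ⟨c, hc, hne⟩ := exists_mem_conductorIdeal_eval_ne_zero hns
    refine hne ?_
    have := MvPolynomial.mem_zeroLocus_iff.1 hβ c hc
    rwa [MvPolynomial.aeval_eq_eval] at this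
  have hfac : ∀ α ∈ subalgSpectrum (A : Set (MvPolynomial (Fin n) K)),
      ∃ q : Fin (N + 1) → MvPolynomial (Fin n) K,
        π α = ∏ j, q j ∧ ∀ j, eval α (q j) = 0 := by
    intro α hα
    obtain ⟨l, hl⟩ := hπ α hα
    exact ⟨_, hl, fun j => by simp⟩
  choose! q hq hq0 using hfac
  suffices h : ∏ α ∈ hfin.toFinset, π α ∈ A.conductorIdeal.radical ^ (N + 1) from
    hN (Ideal.pow_le_pow_right (Nat.le_succ N) h) f
  rw [Finset.prod_congr rfl fun α hα => hq α (hfin.mem_toFinset.1 hα), Finset.prod_comm]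
  have hprod := Ideal.prod_mem_prod (s := (Finset.univ : Finset (Fin (N + 1))))
    (I := fun _ => A.conductorIdeal.radical)
    (x := fun j => ∏ α ∈ hfin.toFinset, q α j) fun j _ =>
      hmem _ fun α hα => by
        rw [map_prod]
        exact Finset.prod_eq_zero (hfin.mem_toFinset.2 hα) (hq0 α hα j)
  simpa only [Finset.prod_const, Finset.card_univ, Fintype.card_fin] using hprod
end
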